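/- arXiv:2303.14454 — 5 statements merged into one kernel-verified Lean document; each statement's English description precedes it below -/
import Mathlib

section
/- Let f be strictly increasing, let all agents have matroid-rank valuations, and let A = (A_1,…,A_n) be an R^tie_f allocation for the agents in N. Then for any subset of agents S ⊆ N, the restricted allocation A_S = (A_i)_{i ∈ S} (with the agents of S keeping their weights, valuations, and relative order) is an R^tie_f allocation of the instance whose set of agents is S and whose set of goods is ∪_{i ∈ S} A_i. -/
open Finset

/-- `v` is a matroid-rank (binary submodular) valuation on the ground set `M`:
binary marginal gains, monotone, submodular, and normalized. -/
def MatroidRank {γ : Type} [DecidableEq γ] (M : Finset γ) (v : Finset γ → ℕ) : Prop :=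
  (∀ S ⊆ M, ∀ g ∈ M, g ∉ S → v (insert g S) = v S ∨ v (insert g S) = v S + 1) ∧
  (∀ S T : Finset γ, S ⊆ T → T ⊆ M → v S ≤ v T) ∧
  (∀ S T : Finset γ, S ⊆ T → T ⊆ M → ∀ g ∈ M, g ∉ T →
    v (insert g T) + v S ≤ v (insert g S) + v T) ∧
  v ∅ = 0

/-- An allocation of (some of) the goods in `M` to `n` agents: pairwise disjoint bundles. -/
def IsAlloc {γ : Type} (n : ℕ) (M : Finset γ) (A : Fin n → Finset γ) : Prop :=
  (∀ i, A i ⊆ M) ∧ ∀ i j : Fin n, i ≠ j → Disjoint (A i) (A j)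

/-- Non-redundancy: every agent's utility equals her bundle size. -/
def NonRedundant {γ : Type} (n : ℕ) (v : Fin n → Finset γ → ℕ) (A : Fin n → Finset γ) : Prop :=
  ∀ i, v i (A i) = (A i).card

/-- Pareto-optimality of an allocation. -/
def ParetoOptimal {γ : Type} (n : ℕ) (M : Finset γ) (v : Fin n → Finset γ → ℕ)
    (A : Fin n → Finset γ) : Prop :=
  ¬ ∃ B : Fin n → Finset γ, IsAlloc n M B ∧ (∀ i, v i (A i) ≤ v i (B i)) ∧
      ∃ i, v i (A i) < v i (B i)

/-- The edge relation of the exchange graph of allocation `A` (vertex set `M`). -/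
def ExEdge {γ : Type} [DecidableEq γ] (n : ℕ) (M : Finset γ) (v : Fin n → Finset γ → ℕ)
    (A : Fin n → Finset γ) (a b : γ) : Prop :=
  a ∈ M ∧ b ∈ M ∧ ∃ i, a ∈ A i ∧ b ∉ A i ∧ v i ((insert b (A i)).erase a) = v i (A i)

/-- `FSet M v B g` : good `g ∈ M` lies outside `B` and adds marginal value `1` to `B`. -/
def FSet {γ : Type} [DecidableEq γ] (M : Finset γ) (v : Finset γ → ℕ) (B : Finset γ)
    (g : γ) : Prop :=
  g ∈ M ∧ g ∉ B ∧ v (insert g B) = v B + 1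

/-- Path augmentation `B △ P`: for each consecutive pair `(gⱼ, gⱼ₊₁)` of the path `P`
with `gⱼ ∈ B`, remove `gⱼ` and add `gⱼ₊₁`. -/
def augmentPath {γ : Type} [DecidableEq γ] (B : Finset γ) (P : List γ) : Finset γ :=
  (B \ (((P.zip P.tail).filter fun p => p.1 ∈ B).map Prod.fst).toFinset) ∪
    (((P.zip P.tail).filter fun p => p.1 ∈ B).map Prod.snd).toFinset

/-- The weighted welfare `∑ i, wᵢ · f(vᵢ(Aᵢ))`. -/
noncomputable def Welfare {γ : Type} (n : ℕ) (w : Fin n → ℝ) (v : Fin n → Finset γ → ℕ)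
    (f : ℕ → EReal) (A : Fin n → Finset γ) : EReal :=
  ∑ i, (w i : EReal) * f (v i (A i))

/-- The set of agents receiving positive utility. -/
def PosAgents {γ : Type} (n : ℕ) (v : Fin n → Finset γ → ℕ) (A : Fin n → Finset γ) :
    Finset (Fin n) :=
  Finset.univ.filter fun i => 0 < v i (A i)

/-- The weighted welfare restricted to the positively-served agents. -/
noncomputable def RWelfare {γ : Type} (n : ℕ) (w : Fin n → ℝ) (v : Fin n → Finset γ → ℕ)
    (f : ℕ → EReal) (A : Fin n → Finset γ) : EReal :=
  ∑ i ∈ PosAgents n v A, (w i : EReal) * f (v i (A i))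

/-- `S` is lexicographically preferred to `T` (favoring lower indices), strictly. -/
def LexLt {n : ℕ} (S T : Finset (Fin n)) : Prop :=
  ∃ i, i ∈ S ∧ i ∉ T ∧ ∀ j, j < i → (j ∈ S ↔ j ∈ T)

/-- `S` is lexicographically weakly preferred to `T` (favoring lower indices). -/
def LexLE {n : ℕ} (S T : Finset (Fin n)) : Prop := S = T ∨ LexLt S T

/-- `A` is an `R_f` allocation: it maximizes the weighted welfare; if the maximum welfare
is `-∞`, it first maximizes the number of positively-served agents (breaking ties between
the sets of positively-served agents lexicographically in favor of lower indices), and then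
maximizes the weighted welfare over the positively-served agents. -/
def IsRf {γ : Type} (n : ℕ) (M : Finset γ) (w : Fin n → ℝ) (v : Fin n → Finset γ → ℕ)
    (f : ℕ → EReal) (A : Fin n → Finset γ) : Prop :=
  IsAlloc n M A ∧
  ((∃ B, IsAlloc n M B ∧ Welfare n w v f B ≠ ⊥) →
    ∀ B, IsAlloc n M B → Welfare n w v f B ≤ Welfare n w v f A) ∧
  ((∀ B, IsAlloc n M B → Welfare n w v f B = ⊥) →
    ∀ B, IsAlloc n M B →
      ((PosAgents n v B).card < (PosAgents n v A).card ∨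
        ((PosAgents n v B).card = (PosAgents n v A).card ∧
          LexLE (PosAgents n v A) (PosAgents n v B))) ∧
      (PosAgents n v B = PosAgents n v A → RWelfare n w v f B ≤ RWelfare n w v f A))

/-- Strict lexicographic order on utility vectors. -/
def VecLexLt (n : ℕ) (u u' : Fin n → ℕ) : Prop :=
  ∃ i, u i < u' i ∧ ∀ j, j < i → u j = u' j

/-- `A` is an `R^tie_f` allocation: an `R_f` allocation that is lexicographically dominating
within the set of `R_f` allocations and non-redundant. -/
def IsRfTie {γ : Type} (n : ℕ) (M : Finset γ) (w : Fin n → ℝ) (v : Fin n → Finset γ → ℕ)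
    (f : ℕ → EReal) (A : Fin n → Finset γ) : Prop :=
  IsRf n M w v f A ∧
  (∀ B, IsRf n M w v f B → ¬ VecLexLt n (fun i => v i (A i)) (fun i => v i (B i))) ∧
  NonRedundant n v A

theorem rl_sum_split {α : Type} [AddCommMonoid α] {m n : ℕ} (e : Fin m → Fin n)
    (he : Function.Injective e) (g : Fin n → α) :
    ∑ i, g i = ∑ j, g (e j) + ∑ i ∈ (Finset.univ.image e)ᶜ, g i := by
  rw [← Finset.sum_add_sum_compl (Finset.univ.image e) g, Finset.sum_image]
  intro a _ b _ h
  exact he h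

theorem rl_sum_real {ι : Type} (s : Finset ι) (g : ι → EReal)
    (h : ∀ i ∈ s, g i ≠ ⊥ ∧ g i ≠ ⊤) : ∃ r : ℝ, ∑ i ∈ s, g i = (r : EReal) := by
  classical
  induction s using Finset.induction_on with
  | empty => exact ⟨0, by simp⟩
  | insert a s ha ih =>
    obtain ⟨r, hr⟩ := ih (fun i hi => h i (Finset.mem_insert_of_mem hi))
    obtain ⟨h1, h2⟩ := h a (Finset.mem_insert_self _ _)
    refine ⟨(g a).toReal + r, ?_⟩
    rw [Finset.sum_insert ha, hr, EReal.coe_add, EReal.coe_toReal h2 h1]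

theorem rl_sum_bot {ι : Type} (s : Finset ι) (g : ι → EReal) (i : ι) (hi : i ∈ s)
    (h : g i = ⊥) : ∑ i ∈ s, g i = ⊥ := by
  classical
  rw [← Finset.add_sum_erase s g hi, h, EReal.bot_add]

theorem rl_mul_fin {x : ℝ} {y : EReal} (h1 : y ≠ ⊥) (h2 : y ≠ ⊤) :
    (x : EReal) * y ≠ ⊥ ∧ (x : EReal) * y ≠ ⊤ := by
  lift y to ℝ using ⟨h2, h1⟩
  rw [← EReal.coe_mul]
  exact ⟨EReal.coe_ne_bot _, EReal.coe_ne_top _⟩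

theorem rl_cancel {a b : EReal} {r : ℝ} (h : a + r ≤ b + r) : a ≤ b := by
  induction a <;> induction b <;> simp_all <;> norm_cast at * <;> simp_all
  rw [← EReal.coe_add] at h
  exact EReal.coe_ne_top _ h

theorem rl_f_pos {f : ℕ → EReal} (hf : StrictMono f) {k : ℕ} (hk : 0 < k) : f k ≠ ⊥ :=
  ne_bot_of_gt (hf hk)

theorem rl_welfare_ne_bot {γ : Type} {n : ℕ} {w : Fin n → ℝ} (hw : ∀ i, 0 < w i)
    {v : Fin n → Finset γ → ℕ} {f : ℕ → EReal} (hftop : ∀ k, f k ≠ ⊤)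
    (A : Fin n → Finset γ) :
    Welfare n w v f A ≠ ⊥ ↔ ∀ i, f (v i (A i)) ≠ ⊥ := by
  constructor
  · intro h i hi
    apply h
    refine rl_sum_bot _ _ i (Finset.mem_univ _) ?_
    rw [hi, EReal.coe_mul_bot_of_pos (hw i)]
  · intro h
    obtain ⟨r, hr⟩ := rl_sum_real Finset.univ (fun i => (w i : EReal) * f (v i (A i)))
      (fun i _ => rl_mul_fin (h i) (hftop _))
    unfold Welfare
    rw [hr]
    exact EReal.coe_ne_bot _

theorem rl_rwelfare {γ : Type} {n : ℕ} {w : Fin n → ℝ}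
    {v : Fin n → Finset γ → ℕ} {f : ℕ → EReal} (A : Fin n → Finset γ) :
    RWelfare n w v f A = ∑ i, if 0 < v i (A i) then (w i : EReal) * f (v i (A i)) else 0 := by
  unfold RWelfare PosAgents
  rw [Finset.sum_filter]

theorem rl_card {γ : Type} {n : ℕ} {v : Fin n → Finset γ → ℕ} (A : Fin n → Finset γ) :
    (PosAgents n v A).card = ∑ i, if 0 < v i (A i) then 1 else 0 := by
  unfold PosAgents
  rw [Finset.card_filter]

theorem rl_lexLt_asymm {n : ℕ} {S T : Finset (Fin n)} (h : LexLt S T) (h' : LexLt T S) :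
    False := by
  obtain ⟨i, hi, hi', H⟩ := h
  obtain ⟨j, hj, hj', H'⟩ := h'
  rcases lt_trichotomy i j with h | h | h
  · exact hi' ((H' i h).2 hi)
  · subst h; exact hi' hj
  · exact hj' ((H j h).2 hj)

theorem rl_lexLE_antisymm {n : ℕ} {S T : Finset (Fin n)} (h : LexLE S T) (h' : LexLE T S) :
    S = T := by
  rcases h with h | h
  · exact h
  rcases h' with h' | h'
  · exact h'.symm
  exact (rl_lexLt_asymm h h').elim

/-- The main argument, for an arbitrary strictly increasing embedding of the agents. -/
theorem rl_main {γ : Type} {m n : ℕ} (M M' : Finset γ)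
    (w : Fin n → ℝ) (hw : ∀ i, 0 < w i)
    (v : Fin n → Finset γ → ℕ)
    (f : ℕ → EReal) (hf : StrictMono f) (hftop : ∀ k, f k ≠ ⊤)
    (A : Fin n → Finset γ) (hA : IsRfTie n M w v f A)
    (e : Fin m → Fin n) (he : StrictMono e)
    (hAM' : ∀ j, A (e j) ⊆ M') (hM'M : M' ⊆ M)
    (hdis : ∀ i, i ∉ Set.range e → Disjoint M' (A i)) :
    IsRfTie m M' (fun j => w (e j)) (fun j => v (e j)) f (fun j => A (e j)) := by
  classical
  obtain ⟨⟨hAall, hA1, hA2⟩, hAlex, hAnr⟩ := hA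
  -- extension of allocations
  have ext : ∀ B' : Fin m → Finset γ, IsAlloc m M' B' → ∃ B : Fin n → Finset γ,
      IsAlloc n M B ∧ (∀ j, B (e j) = B' j) ∧ ∀ i, i ∉ Set.range e → B i = A i := by
    intro B' hB'
    refine ⟨fun i => if h : ∃ j, e j = i then B' h.choose else A i, ⟨?_, ?_⟩, ?_, ?_⟩
    · intro i
      dsimp only
      split_ifs with h
      · exact (hB'.1 _).trans hM'M
      · exact hAall.1 i
    · intro i j hij
      dsimp only
      split_ifs with h h' h'
      · apply hB'.2
        intro hc
        apply hij
        rw [← h.choose_spec, ← h'.choose_spec, hc]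
      · exact Disjoint.mono_left (hB'.1 _) (hdis j h')
      · exact (Disjoint.mono_left (hB'.1 _) (hdis i h)).symm
      · exact hAall.2 i j hij
    · intro j
      have h : ∃ k, e k = e j := ⟨j, rfl⟩
      dsimp only
      rw [dif_pos h]
      congr 1
      exact he.injective h.choose_spec
    · intro i hi
      dsimp only
      exact dif_neg hi
  have hcompl : ∀ i, i ∈ (Finset.univ.image e)ᶜ → i ∉ Set.range e := by
    intro i hi
    simpa using hi
  have hA'all : IsAlloc m M' (fun j => A (e j)) :=
    ⟨hAM', fun i j hij => hAall.2 _ _ (fun h => hij (he.injective h))⟩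
  -- decompositions
  have decW : ∀ B : Fin n → Finset γ, (∀ i, i ∉ Set.range e → B i = A i) →
      Welfare n w v f B = Welfare m (fun j => w (e j)) (fun j => v (e j)) f (fun j => B (e j))
        + ∑ i ∈ (Finset.univ.image e)ᶜ, (w i : EReal) * f (v i (A i)) := by
    intro B hB
    unfold Welfare
    rw [rl_sum_split e he.injective]
    congr 1
    exact Finset.sum_congr rfl (fun i hi => by rw [hB i (hcompl i hi)])
  have decR : ∀ B : Fin n → Finset γ, (∀ i, i ∉ Set.range e → B i = A i) →
      RWelfare n w v f B = RWelfare m (fun j => w (e j)) (fun j => v (e j)) f (fun j => B (e j))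
        + ∑ i ∈ (Finset.univ.image e)ᶜ,
          if 0 < v i (A i) then (w i : EReal) * f (v i (A i)) else 0 := by
    intro B hB
    rw [rl_rwelfare, rl_rwelfare, rl_sum_split e he.injective]
    congr 1
    exact Finset.sum_congr rfl (fun i hi => by rw [hB i (hcompl i hi)])
  have decC : ∀ B : Fin n → Finset γ, (∀ i, i ∉ Set.range e → B i = A i) →
      (PosAgents n v B).card = (PosAgents m (fun j => v (e j)) (fun j => B (e j))).card
        + ∑ i ∈ (Finset.univ.image e)ᶜ, if 0 < v i (A i) then 1 else 0 := by
    intro B hB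
    rw [rl_card, rl_card, rl_sum_split e he.injective]
    congr 1
    exact Finset.sum_congr rfl (fun i hi => by rw [hB i (hcompl i hi)])
  obtain ⟨r, hr⟩ := rl_sum_real (Finset.univ.image e)ᶜ
    (fun i => if 0 < v i (A i) then (w i : EReal) * f (v i (A i)) else 0) (by
      intro i _
      split_ifs with h
      · exact rl_mul_fin (rl_f_pos hf h) (hftop _)
      · exact ⟨EReal.zero_ne_bot, EReal.zero_ne_top⟩)
  have lexPush : ∀ B : Fin n → Finset γ, (∀ i, i ∉ Set.range e → B i = A i) →
      VecLexLt m (fun j => v (e j) (A (e j))) (fun j => v (e j) (B (e j))) →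
      VecLexLt n (fun i => v i (A i)) (fun i => v i (B i)) := by
    rintro B hB ⟨i, hi, H⟩
    refine ⟨e i, hi, fun j hj => ?_⟩
    by_cases hj' : j ∈ Set.range e
    · obtain ⟨k, rfl⟩ := hj'
      exact H k (he.lt_iff_lt.1 hj)
    · dsimp only
      rw [hB j hj']
  have posEq : ∀ B : Fin n → Finset γ, (∀ i, i ∉ Set.range e → B i = A i) →
      PosAgents m (fun j => v (e j)) (fun j => B (e j)) =
        PosAgents m (fun j => v (e j)) (fun j => A (e j)) →
      PosAgents n v B = PosAgents n v A := by
    intro B hB h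
    ext i
    by_cases hi : i ∈ Set.range e
    · obtain ⟨k, rfl⟩ := hi
      have := congrArg (fun s => k ∈ s) h
      simpa [PosAgents] using this
    · simp [PosAgents, hB i hi]
  have lexPull : ∀ B : Fin n → Finset γ, (∀ i, i ∉ Set.range e → B i = A i) →
      LexLE (PosAgents n v A) (PosAgents n v B) →
      LexLE (PosAgents m (fun j => v (e j)) (fun j => A (e j)))
        (PosAgents m (fun j => v (e j)) (fun j => B (e j))) := by
    intro B hB h
    rcases h with h | ⟨i, hi, hi', H⟩
    · left
      ext k
      have := congrArg (fun s => e k ∈ s) h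
      simpa [PosAgents] using this
    · right
      by_cases hir : i ∈ Set.range e
      · obtain ⟨k, rfl⟩ := hir
        refine ⟨k, by simpa [PosAgents] using hi, by simpa [PosAgents] using hi', fun j hj => ?_⟩
        have := H (e j) (he hj)
        simpa [PosAgents] using this
      · simp [PosAgents, hB i hir] at hi hi'
        omega
  by_cases hcase : ∃ B, IsAlloc n M B ∧ Welfare n w v f B ≠ ⊥
  · -- the maximum welfare is finite
    have hmax := hA1 hcase
    obtain ⟨B0, hB0, hB0n⟩ := hcase
    have hAn : Welfare n w v f A ≠ ⊥ := fun h => hB0n (le_bot_iff.1 (h ▸ hmax B0 hB0))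
    have hAf := (rl_welfare_ne_bot hw hftop A).1 hAn
    have hA'n : Welfare m (fun j => w (e j)) (fun j => v (e j)) f (fun j => A (e j)) ≠ ⊥ :=
      (rl_welfare_ne_bot (fun j => hw (e j)) hftop _).2 (fun j => hAf (e j))
    obtain ⟨c, hc⟩ := rl_sum_real (Finset.univ.image e)ᶜ
      (fun i => (w i : EReal) * f (v i (A i))) (fun i _ => rl_mul_fin (hAf i) (hftop _))
    have hA'max : ∀ B', IsAlloc m M' B' →
        Welfare m (fun j => w (e j)) (fun j => v (e j)) f B' ≤
        Welfare m (fun j => w (e j)) (fun j => v (e j)) f (fun j => A (e j)) := by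
      intro B' hB'
      obtain ⟨B, hB, hBe, hBo⟩ := ext B' hB'
      obtain rfl : (fun j => B (e j)) = B' := funext hBe
      have h := hmax B hB
      rw [decW B hBo, decW A (fun _ _ => rfl), hc] at h
      exact rl_cancel h
    refine ⟨⟨hA'all, fun _ => hA'max, fun h => (hA'n (h _ hA'all)).elim⟩, ?_, fun j => hAnr (e j)⟩
    intro B' hB' hlt
    obtain ⟨B, hB, hBe, hBo⟩ := ext B' hB'.1
    obtain rfl : (fun j => B (e j)) = B' := funext hBe
    refine hAlex B ⟨hB, ?_, fun h => (hAn (h A hAall)).elim⟩ (lexPush B hBo hlt)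
    intro _ C hC
    refine (hmax C hC).trans ?_
    rw [decW B hBo, decW A (fun _ _ => rfl)]
    gcongr
    exact hB'.2.1 ⟨_, hA'all, hA'n⟩ _ hA'all
  · -- the maximum welfare is minus infinity
    have hbot : ∀ B, IsAlloc n M B → Welfare n w v f B = ⊥ := by
      intro B hB
      by_contra h
      exact hcase ⟨B, hB, h⟩
    have hmax := hA2 hbot
    have f0 : f 0 = ⊥ := by
      by_contra h
      refine hcase ⟨A, hAall, (rl_welfare_ne_bot hw hftop A).2 (fun i => ?_)⟩
      rcases Nat.eq_zero_or_pos (v i (A i)) with h0 | h0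
      · rwa [h0]
      · exact rl_f_pos hf h0
    have fpos : ∀ k, f k ≠ ⊥ ↔ 0 < k := by
      intro k
      refine ⟨fun h => Nat.pos_of_ne_zero (fun hk => h (hk ▸ f0)), rl_f_pos hf⟩
    have hRmax : ∀ B', IsAlloc m M' B' →
        PosAgents m (fun j => v (e j)) B' =
          PosAgents m (fun j => v (e j)) (fun j => A (e j)) →
        RWelfare m (fun j => w (e j)) (fun j => v (e j)) f B' ≤
        RWelfare m (fun j => w (e j)) (fun j => v (e j)) f (fun j => A (e j)) := by
      intro B' hB' hP
      obtain ⟨B, hB, hBe, hBo⟩ := ext B' hB'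
      obtain rfl : (fun j => B (e j)) = B' := funext hBe
      have h := (hmax B hB).2 (posEq B hBo hP)
      rw [decR B hBo, decR A (fun _ _ => rfl), hr] at h
      exact rl_cancel h
    have hPmax : ∀ B', IsAlloc m M' B' →
        ((PosAgents m (fun j => v (e j)) B').card <
            (PosAgents m (fun j => v (e j)) (fun j => A (e j))).card ∨
        ((PosAgents m (fun j => v (e j)) B').card =
            (PosAgents m (fun j => v (e j)) (fun j => A (e j))).card ∧
          LexLE (PosAgents m (fun j => v (e j)) (fun j => A (e j)))
            (PosAgents m (fun j => v (e j)) B'))) := by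
      intro B' hB'
      obtain ⟨B, hB, hBe, hBo⟩ := ext B' hB'
      obtain rfl : (fun j => B (e j)) = B' := funext hBe
      have h := (hmax B hB).1
      rw [decC B hBo, decC A (fun _ _ => rfl)] at h
      rcases h with h | ⟨h, h'⟩
      · left; omega
      · right; exact ⟨by omega, lexPull B hBo h'⟩
    -- transferring optimality back
    have back : ∀ B : Fin n → Finset γ, IsAlloc n M B → (∀ i, i ∉ Set.range e → B i = A i) →
        PosAgents m (fun j => v (e j)) (fun j => B (e j)) =
          PosAgents m (fun j => v (e j)) (fun j => A (e j)) →
        RWelfare m (fun j => w (e j)) (fun j => v (e j)) f (fun j => A (e j)) ≤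
        RWelfare m (fun j => w (e j)) (fun j => v (e j)) f (fun j => B (e j)) →
        IsRf n M w v f B := by
      intro B hB hBo hP hR
      refine ⟨hB, fun h => (hcase h).elim, fun _ C hC => ?_⟩
      rw [posEq B hBo hP]
      refine ⟨(hmax C hC).1, fun h => ((hmax C hC).2 h).trans ?_⟩
      rw [decR B hBo, decR A (fun _ _ => rfl)]
      gcongr
    by_cases hcase' : ∃ B', IsAlloc m M' B' ∧
        Welfare m (fun j => w (e j)) (fun j => v (e j)) f B' ≠ ⊥
    · have univ_iff : ∀ B', Welfare m (fun j => w (e j)) (fun j => v (e j)) f B' ≠ ⊥ ↔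
          PosAgents m (fun j => v (e j)) B' = Finset.univ := by
        intro B'
        rw [rl_welfare_ne_bot (fun j => hw (e j)) hftop]
        simp [PosAgents, fpos, Finset.filter_eq_self]
      have WR : ∀ B', PosAgents m (fun j => v (e j)) B' = Finset.univ →
          Welfare m (fun j => w (e j)) (fun j => v (e j)) f B' =
          RWelfare m (fun j => w (e j)) (fun j => v (e j)) f B' := by
        intro B' h
        unfold Welfare RWelfare
        rw [h]
      obtain ⟨B0, hB0, hB0n⟩ := hcase'
      have hAu : PosAgents m (fun j => v (e j)) (fun j => A (e j)) = Finset.univ := by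
        have h := hPmax B0 hB0
        rw [(univ_iff B0).1 hB0n] at h
        apply Finset.eq_univ_of_card
        rw [Finset.card_univ] at h
        have := Finset.card_le_univ (PosAgents m (fun j => v (e j)) (fun j => A (e j)))
        omega
      have hA'n := (univ_iff _).2 hAu
      refine ⟨⟨hA'all, fun _ B' hB' => ?_, fun h => (hA'n (h _ hA'all)).elim⟩, ?_,
        fun j => hAnr (e j)⟩
      · by_cases hn : Welfare m (fun j => w (e j)) (fun j => v (e j)) f B' = ⊥
        · rw [hn]; exact bot_le
        · have hu := (univ_iff B').1 hn
          rw [WR _ hu, WR _ hAu]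
          exact hRmax B' hB' (hu.trans hAu.symm)
      · intro B' hB' hlt
        obtain ⟨B, hB, hBe, hBo⟩ := ext B' hB'.1
        obtain rfl : (fun j => B (e j)) = B' := funext hBe
        have hle := hB'.2.1 ⟨_, hA'all, hA'n⟩ _ hA'all
        have hBn : Welfare m (fun j => w (e j)) (fun j => v (e j)) f (fun j => B (e j)) ≠ ⊥ :=
          fun h => hA'n (le_bot_iff.1 (h ▸ hle))
        have hu := (univ_iff _).1 hBn
        rw [WR _ hu, WR _ hAu] at hle
        exact hAlex B (back B hB hBo (hu.trans hAu.symm) hle) (lexPush B hBo hlt)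
    · have hbot' : ∀ B', IsAlloc m M' B' →
          Welfare m (fun j => w (e j)) (fun j => v (e j)) f B' = ⊥ := by
        intro B' hB'
        by_contra h
        exact hcase' ⟨B', hB', h⟩
      refine ⟨⟨hA'all, fun h => (hcase' h).elim,
        fun _ B' hB' => ⟨hPmax B' hB', hRmax B' hB'⟩⟩, ?_, fun j => hAnr (e j)⟩
      intro B' hB' hlt
      obtain ⟨B, hB, hBe, hBo⟩ := ext B' hB'.1
      obtain rfl : (fun j => B (e j)) = B' := funext hBe
      obtain ⟨h1, h2⟩ := hB'.2.2 hbot' _ hA'all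
      have hP : PosAgents m (fun j => v (e j)) (fun j => B (e j)) =
          PosAgents m (fun j => v (e j)) (fun j => A (e j)) := by
        have h3 := hPmax _ hB'.1
        rcases h1 with h1 | ⟨_, h1⟩
        · omega
        · rcases h3 with h3 | ⟨_, h3⟩
          · omega
          · exact rl_lexLE_antisymm h1 h3
      exact hAlex B (back B hB hBo hP (h2 hP.symm)) (lexPush B hBo hlt)

/-- Restriction lemma: if `A` is an `R^tie_f` allocation for the agents of `Fin n`, then for
any subset `S` of agents, restricting `A` to the agents of `S` (keeping their weights,
valuations, and relative order) is an `R^tie_f` allocation of the instance with agent set `S`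
and goods `⋃ i ∈ S, A i`. -/
theorem restrictionLemma {γ : Type} [DecidableEq γ] {n : ℕ} (M : Finset γ)
    (w : Fin n → ℝ) (hw : ∀ i, 0 < w i)
    (v : Fin n → Finset γ → ℕ) (hv : ∀ i, MatroidRank M (v i))
    (f : ℕ → EReal) (hf : StrictMono f) (hftop : ∀ k, f k ≠ ⊤)
    (A : Fin n → Finset γ) (hA : IsRfTie n M w v f A)
    (S : Finset (Fin n)) :
    IsRfTie S.card (S.biUnion A)
      (fun j => w (S.orderIsoOfFin rfl j).1)
      (fun j => v (S.orderIsoOfFin rfl j).1)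
      f
      (fun j => A (S.orderIsoOfFin rfl j).1) := by
  refine rl_main M (S.biUnion A) w hw v f hf hftop A hA
    (fun j => (S.orderIsoOfFin rfl j).1) ?_ ?_ ?_ ?_
  · intro a b hab
    exact (S.orderIsoOfFin rfl).strictMono hab
  · intro j
    exact Finset.subset_biUnion_of_mem A (S.orderIsoOfFin rfl j).2
  · exact Finset.biUnion_subset.2 (fun i _ => hA.1.1.1 i)
  · intro i hi
    rw [Finset.disjoint_biUnion_left]
    intro k hk
    apply hA.1.1.2
    rintro rfl
    exact hi ⟨(S.orderIsoOfFin rfl).symm ⟨k, hk⟩, by simp⟩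
end

section
/- Let f be strictly increasing and concave, and let all agents have matroid-rank valuations. Let I be an instance with agents N, and let I' be obtained from I by adding one extra agent (with her own positive weight and matroid-rank valuation; the original agents keep their weights, valuations, and relative order in the lexicographic tie-breaking). If A is an R^tie_f allocation of I and A' is an R^tie_f allocation of I', then v_i(A'_i) ≤ v_i(A_i) for every original agent i ∈ N. (That is, the rule R^tie_f is population-monotone.) -/
open Finset

section Feas

variable {γ : Type} [DecidableEq γ] {M : Finset γ}

theorem mr_diff {v : Finset γ → ℕ} (hv : MatroidRank M v) {S T : Finset γ} (hST : S ⊆ T)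
    (hT : T ⊆ M) (X : Finset γ) (hX : X ⊆ M) : v (T ∪ X) + v S ≤ v (S ∪ X) + v T := by
  obtain ⟨-, hmono, hsub, -⟩ := hv
  induction X using Finset.induction_on with
  | empty => simp [add_comm]
  | insert g X hg ih =>
    have hgM : g ∈ M := hX (mem_insert_self _ _)
    have hXM : X ⊆ M := fun a ha => hX (mem_insert_of_mem ha)
    have ih := ih hXM
    rw [union_insert, union_insert]
    by_cases h : g ∈ T ∪ X
    · rw [insert_eq_of_mem h]
      have := hmono (S ∪ X) (insert g (S ∪ X)) (subset_insert _ _)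
        (insert_subset hgM (union_subset (hST.trans hT) hXM))
      omega
    · have := hsub (S ∪ X) (T ∪ X) (union_subset_union hST (Subset.refl _))
        (union_subset hT hXM) g hgM h
      omega

theorem mr_submod {v : Finset γ → ℕ} (hv : MatroidRank M v) {A B : Finset γ}
    (hA : A ⊆ M) (hB : B ⊆ M) : v (A ∪ B) + v (A ∩ B) ≤ v A + v B := by
  have := mr_diff hv (inter_subset_left (s₁ := A) (s₂ := B)) hA B hB
  rw [union_eq_right.2 (inter_subset_right (s₁ := A) (s₂ := B))] at this
  omega

theorem mr_mono {v : Finset γ → ℕ} (hv : MatroidRank M v) {A B : Finset γ}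
    (h : A ⊆ B) (hB : B ⊆ M) : v A ≤ v B := hv.2.1 A B h hB

theorem mr_card {v : Finset γ → ℕ} (hv : MatroidRank M v) {S : Finset γ} (hS : S ⊆ M)
    (X : Finset γ) (hX : X ⊆ M) : v (S ∪ X) ≤ v S + X.card := by
  induction X using Finset.induction_on with
  | empty => simp
  | insert g X hg ih =>
    have hgM : g ∈ M := hX (mem_insert_self _ _)
    have hXM : X ⊆ M := fun a ha => hX (mem_insert_of_mem ha)
    have ih := ih hXM
    rw [union_insert, card_insert_of_notMem hg]
    by_cases h : g ∈ S ∪ X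
    · rw [insert_eq_of_mem h]; omega
    · rcases hv.1 (S ∪ X) (union_subset hS hXM) g hgM h with h | h <;> omega

theorem mr_shrink {v : Finset γ → ℕ} (hv : MatroidRank M v) (S : Finset γ) (hS : S ⊆ M)
    (k : ℕ) (hk : k ≤ v S) : ∃ T ⊆ S, v T = k := by
  induction S using Finset.induction_on with
  | empty => exact ⟨∅, Subset.refl _, by have := hv.2.2.2; omega⟩
  | insert g X hg ih =>
    have hgM : g ∈ M := hS (mem_insert_self _ _)
    have hXM : X ⊆ M := fun a ha => hS (mem_insert_of_mem ha)
    by_cases h : k ≤ v X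
    · obtain ⟨T, hT, h⟩ := ih hXM h
      exact ⟨T, hT.trans (subset_insert _ _), h⟩
    · refine ⟨_, Subset.refl _, ?_⟩
      rcases hv.1 X hXM g hgM hg with h | h <;> omega

variable {ι : Type} [Fintype ι] [DecidableEq ι]

theorem sum_exch (S T : Finset ι) (a b c d : ι → ℤ)
    (h1 : ∀ k ∈ S, k ∉ T → c k ≤ a k) (h2 : ∀ k ∈ T, k ∉ S → c k ≤ b k)
    (h3 : ∀ k ∈ S, k ∈ T → c k + d k ≤ a k + b k) :
    ∑ k ∈ S ∪ T, c k + ∑ k ∈ S ∩ T, d k ≤ ∑ k ∈ S, a k + ∑ k ∈ T, b k := by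
  have e : ∀ (U : Finset ι) (x : ι → ℤ), ∑ k ∈ U, x k = ∑ k, if k ∈ U then x k else 0 := by
    intro U x; simp
  rw [e (S ∪ T), e (S ∩ T), e S, e T, ← sum_add_distrib, ← sum_add_distrib]
  apply sum_le_sum
  intro k _
  have := h1 k; have := h2 k; have := h3 k
  by_cases hS : k ∈ S <;> by_cases hT : k ∈ T <;> simp_all

theorem card_compl_modular (Z W : Finset γ) :
    ((M \ (Z ∩ W)).card : ℤ) + (M \ (Z ∪ W)).card = (M \ Z).card + (M \ W).card := by
  have := card_union_add_card_inter (M \ Z) (M \ W)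
  have e1 : M \ Z ∪ M \ W = M \ (Z ∩ W) := by ext; simp; tauto
  have e2 : M \ Z ∩ (M \ W) = M \ (Z ∪ W) := by ext; simp; tauto
  rw [e1, e2] at this
  exact_mod_cast this

/-- Rado-type condition. -/
def RCond (M : Finset γ) (v : ι → Finset γ → ℕ) (G : ι → Finset γ) (x : ι → ℤ) : Prop :=
  ∀ S : Finset ι, ∀ Z ⊆ M, ∑ k ∈ S, x k ≤ ∑ k ∈ S, (v k (Z ∩ G k) : ℤ) + (M \ Z).card

theorem rado_aux {v : ι → Finset γ → ℕ} (hv : ∀ i, MatroidRank M (v i)) (x : ι → ℤ) :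
    ∀ (N : ℕ) (G : ι → Finset γ), ∑ k, (G k).card = N → (∀ k, G k ⊆ M) → RCond M v G x →
      ∃ B : ι → Finset γ, (∀ k, B k ⊆ M) ∧ (∀ k l, k ≠ l → Disjoint (B k) (B l)) ∧
        ∀ k, x k ≤ v k (B k) := by
  intro N
  induction N using Nat.strong_induction_on with
  | _ N ih =>
  intro G hN hG hR
  by_cases hd : ∀ k l, k ≠ l → Disjoint (G k) (G l)
  · refine ⟨G, hG, hd, fun k => ?_⟩
    have := hR {k} M (Subset.refl _)
    simpa [inter_eq_right.2 (hG k)] using this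
  push Not at hd
  obtain ⟨k, l, hkl, hd⟩ := hd
  rw [not_disjoint_iff] at hd
  obtain ⟨g, hgk, hgl⟩ := hd
  have step : ∀ m, g ∈ G m → RCond M v (Function.update G m ((G m).erase g)) x → 
      ∃ B : ι → Finset γ, (∀ k, B k ⊆ M) ∧ (∀ k l, k ≠ l → Disjoint (B k) (B l)) ∧
        ∀ k, x k ≤ v k (B k) := by
    intro m hm hr
    refine ih _ ?_ _ rfl ?_ hr
    · rw [← hN]
      apply sum_lt_sum
      · intro t _
        by_cases h : t = m
        · subst h; simpa using card_le_card (erase_subset _ _)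
        · simp [h]
      · exact ⟨m, mem_univ _, by simpa using card_lt_card (erase_ssubset hm)⟩
    · intro t
      by_cases h : t = m
      · subst h; simpa using (erase_subset _ _).trans (hG t)
      · simpa [h] using hG t
  by_contra hcon
  have hk : ¬ _ := fun h => hcon (step k hgk h)
  have hl : ¬ _ := fun h => hcon (step l hgl h)
  unfold RCond at hk hl
  push Not at hk hl
  obtain ⟨S, Z, hZ, hS⟩ := hk
  obtain ⟨T, W, hW, hT⟩ := hl
  have fact : ∀ (m : ι) (S : Finset ι) (Z : Finset γ), Z ⊆ M →
      ∑ t ∈ S, (v t (Z ∩ Function.update G m ((G m).erase g) t) : ℤ) + (M \ Z).card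
        < ∑ t ∈ S, x t → g ∈ Z := by
    intro m S Z hZ h
    by_contra hg
    have h2 := hR S Z hZ
    have : ∀ t, Z ∩ Function.update G m ((G m).erase g) t = Z ∩ G t := by
      intro t
      by_cases h : t = m
      · subst h
        simp only [Function.update_self]
        ext a; simp only [mem_inter, mem_erase]
        constructor
        · tauto
        · rintro ⟨h1, h2⟩; exact ⟨h1, fun h => hg (h ▸ h1), h2⟩
      · simp [h]
    simp only [this] at h
    linarith
  have hgZ := fact k S Z hZ hS
  have hgW := fact l T W hW hT
  have h1 := hR (S ∪ T) ((Z ∩ W).erase g)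
    ((erase_subset _ _).trans (inter_subset_left.trans hZ))
  have h2 := hR (S ∩ T) (Z ∪ W) (union_subset hZ hW)
  have hgM : g ∈ M := hZ hgZ
  have hc : ((M \ (Z ∩ W).erase g).card : ℤ) = (M \ (Z ∩ W)).card + 1 := by
    rw [sdiff_erase hgM, card_insert_of_notMem (by simp [hgZ, hgW])]; push_cast; ring
  have hmod := card_compl_modular (M := M) Z W
  have hx : ∑ t ∈ S ∪ T, x t + ∑ t ∈ S ∩ T, x t = ∑ t ∈ S, x t + ∑ t ∈ T, x t :=
    sum_union_inter
  have key := sum_exch S T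
    (fun t => (v t (Z ∩ Function.update G k ((G k).erase g) t) : ℤ))
    (fun t => (v t (W ∩ Function.update G l ((G l).erase g) t) : ℤ))
    (fun t => (v t ((Z ∩ W).erase g ∩ G t) : ℤ))
    (fun t => (v t ((Z ∪ W) ∩ G t) : ℤ))
    (by
      intro t _ _
      have : (Z ∩ W).erase g ∩ G t ⊆ Z ∩ Function.update G k ((G k).erase g) t := by
        by_cases h : t = k
        · subst h
          intro a; simp; tauto
        · intro a; simp [h] <;> tauto
      exact_mod_cast mr_mono (hv t) this (inter_subset_left.trans hZ))
    (by
      intro t _ _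
      have : (Z ∩ W).erase g ∩ G t ⊆ W ∩ Function.update G l ((G l).erase g) t := by
        by_cases h : t = l
        · subst h
          intro a; simp; tauto
        · intro a; simp [h] <;> tauto
      exact_mod_cast mr_mono (hv t) this (inter_subset_left.trans hW))
    (by
      intro t _ _
      have hs := mr_submod (hv t)
        (A := Z ∩ Function.update G k ((G k).erase g) t)
        (B := W ∩ Function.update G l ((G l).erase g) t)
        (inter_subset_left.trans hZ) (inter_subset_left.trans hW)
      have e1 : v t ((Z ∩ W).erase g ∩ G t) ≤ v t ((Z ∩ Function.update G k ((G k).erase g) t) ∩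
        (W ∩ Function.update G l ((G l).erase g) t)) := by
        apply mr_mono (hv t) _ (inter_subset_left.trans (inter_subset_left.trans hZ))
        intro a ha
        simp only [mem_inter, mem_erase] at ha
        by_cases h : t = k
        · have h' : t ≠ l := fun h' => hkl (h.symm.trans h')
          subst h; simp [h']; tauto
        · by_cases h' : t = l
          · subst h'; simp [h]; tauto
          · simp [h, h']; tauto
      have e2 : v t ((Z ∪ W) ∩ G t) ≤ v t ((Z ∩ Function.update G k ((G k).erase g) t) ∪
        (W ∩ Function.update G l ((G l).erase g) t)) := by
        apply mr_mono (hv t) _ (union_subset (inter_subset_left.trans hZ)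
          (inter_subset_left.trans hW))
        intro a ha
        simp only [mem_inter, mem_union] at ha
        by_cases h : t = k
        · have h' : t ≠ l := fun h' => hkl (h.symm.trans h')
          subst h
          by_cases hag : a = g
          · subst hag; simp [h']; tauto
          · simp [h', hag]; tauto
        · by_cases h' : t = l
          · subst h'
            by_cases hag : a = g
            · subst hag; simp [h]; tauto
            · simp [h, hag]; tauto
          · simp [h, h']; tauto
      have : v t ((Z ∩ W).erase g ∩ G t) + v t ((Z ∪ W) ∩ G t) ≤
        v t (Z ∩ Function.update G k ((G k).erase g) t) +
        v t (W ∩ Function.update G l ((G l).erase g) t) := by omega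
      exact_mod_cast this)
  linarith

/-- Feasibility of a utility vector through the min-max condition. -/
def Feas (M : Finset γ) (v : ι → Finset γ → ℕ) (x : ι → ℤ) : Prop :=
  ∀ S : Finset ι, ∀ Z ⊆ M, ∑ k ∈ S, x k ≤ ∑ k ∈ S, (v k Z : ℤ) + (M \ Z).card

theorem feas_to_alloc {v : ι → Finset γ → ℕ} (hv : ∀ i, MatroidRank M (v i)) (x : ι → ℕ)
    (h : Feas M v (fun k => (x k : ℤ))) :
    ∃ B : ι → Finset γ, (∀ k, B k ⊆ M) ∧ (∀ k l, k ≠ l → Disjoint (B k) (B l)) ∧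
        ∀ k, v k (B k) = x k := by
  obtain ⟨B, h1, h2, h3⟩ := rado_aux hv (fun k => (x k : ℤ)) _ (fun _ => M) rfl
    (fun _ => Subset.refl _) (by
      intro S Z hZ
      have := h S Z hZ
      simpa [inter_eq_left.2 hZ] using this)
  have h3 : ∀ k, ∃ T ⊆ B k, v k T = x k := fun k =>
    mr_shrink (hv k) (B k) (h1 k) (x k) (by exact_mod_cast h3 k)
  choose T hT hT' using h3
  exact ⟨T, fun k => (hT k).trans (h1 k),
    fun k l hkl => disjoint_of_subset_left (hT k) (disjoint_of_subset_right (hT l) (h2 k l hkl)),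
    hT'⟩

theorem alloc_to_feas {v : ι → Finset γ → ℕ} (hv : ∀ i, MatroidRank M (v i))
    (B : ι → Finset γ) (h1 : ∀ k, B k ⊆ M) (h2 : ∀ k l, k ≠ l → Disjoint (B k) (B l)) :
    Feas M v (fun k => (v k (B k) : ℤ)) := by
  intro S Z hZ
  have h : ∀ k, v k (B k) ≤ v k Z + (B k \ Z).card := by
    intro k
    have := mr_card (hv k) (S := B k ∩ Z) (inter_subset_left.trans (h1 k)) (B k \ Z)
      (sdiff_subset.trans (h1 k))
    rw [show B k ∩ Z ∪ B k \ Z = B k by rw [union_comm, sdiff_union_inter]] at this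
    have := mr_mono (hv k) (inter_subset_right (s₁ := B k)) hZ
    omega
  have hc : ∑ k ∈ S, (B k \ Z).card ≤ (M \ Z).card := by
    rw [← card_biUnion]
    · apply card_le_card
      intro a
      simp only [mem_biUnion, mem_sdiff]
      rintro ⟨k, -, h, h'⟩
      exact ⟨h1 k h, h'⟩
    · intro k _ l _ hkl
      exact disjoint_of_subset_left sdiff_subset
        (disjoint_of_subset_right sdiff_subset (h2 k l hkl))
  have : ∑ k ∈ S, v k (B k) ≤ ∑ k ∈ S, v k Z + (M \ Z).card :=
    calc _ ≤ ∑ k ∈ S, (v k Z + (B k \ Z).card) := sum_le_sum fun k _ => h k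
      _ = ∑ k ∈ S, v k Z + ∑ k ∈ S, (B k \ Z).card := sum_add_distrib
      _ ≤ _ := by omega
  simp only
  exact_mod_cast this

theorem rho_submod {v : ι → Finset γ → ℕ} (hv : ∀ i, MatroidRank M (v i))
    (S T : Finset ι) {Z W : Finset γ} (hZ : Z ⊆ M) (hW : W ⊆ M) :
    (∑ k ∈ S ∪ T, (v k (Z ∩ W) : ℤ) + (M \ (Z ∩ W)).card) +
      (∑ k ∈ S ∩ T, (v k (Z ∪ W) : ℤ) + (M \ (Z ∪ W)).card) ≤
    (∑ k ∈ S, (v k Z : ℤ) + (M \ Z).card) + (∑ k ∈ T, (v k W : ℤ) + (M \ W).card) := by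
  have := sum_exch S T (fun k => (v k Z : ℤ)) (fun k => (v k W : ℤ))
    (fun k => (v k (Z ∩ W) : ℤ)) (fun k => (v k (Z ∪ W) : ℤ))
    (fun k _ _ => by exact_mod_cast mr_mono (hv k) inter_subset_left hZ)
    (fun k _ _ => by exact_mod_cast mr_mono (hv k) inter_subset_right hW)
    (fun k _ _ => by
      have := mr_submod (hv k) hZ hW
      have : v k (Z ∩ W) + v k (Z ∪ W) ≤ v k Z + v k W := by omega
      exact_mod_cast this)
  have hmod := card_compl_modular (M := M) Z W
  linarith

def Tight (M : Finset γ) (v : ι → Finset γ → ℕ) (x : ι → ℤ) (S : Finset ι) (Z : Finset γ) :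
    Prop := Z ⊆ M ∧ ∑ k ∈ S, (v k Z : ℤ) + (M \ Z).card ≤ ∑ k ∈ S, x k

theorem tight_lattice {v : ι → Finset γ → ℕ} (hv : ∀ i, MatroidRank M (v i)) {x : ι → ℤ}
    (hx : Feas M v x) {S T : Finset ι} {Z W : Finset γ} (h1 : Tight M v x S Z)
    (h2 : Tight M v x T W) : Tight M v x (S ∪ T) (Z ∩ W) ∧ Tight M v x (S ∩ T) (Z ∪ W) := by
  obtain ⟨hZ, h1⟩ := h1
  obtain ⟨hW, h2⟩ := h2
  have hs := rho_submod hv S T hZ hW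
  have a := hx (S ∪ T) (Z ∩ W) (inter_subset_left.trans hZ)
  have b := hx (S ∩ T) (Z ∪ W) (union_subset hZ hW)
  have e : ∑ t ∈ S ∪ T, x t + ∑ t ∈ S ∩ T, x t = ∑ t ∈ S, x t + ∑ t ∈ T, x t :=
    sum_union_inter
  exact ⟨⟨inter_subset_left.trans hZ, by linarith⟩, ⟨union_subset hZ hW, by linarith⟩⟩

theorem sum_single_one (S : Finset ι) (i : ι) :
    ∑ k ∈ S, (Pi.single i 1 : ι → ℤ) k = if i ∈ S then 1 else 0 := by
  simp [Pi.single_apply]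

theorem not_feas_tight {v : ι → Finset γ → ℕ} {x : ι → ℤ} (hx : Feas M v x) (i j : ι)
    (h : ¬ Feas M v (x + Pi.single i 1 - Pi.single j 1)) :
    ∃ S Z, Tight M v x S Z ∧ i ∈ S ∧ j ∉ S := by
  unfold Feas at h
  push Not at h
  obtain ⟨S, Z, hZ, h⟩ := h
  have := hx S Z hZ
  simp only [Pi.sub_apply, Pi.add_apply, sum_sub_distrib, sum_add_distrib,
    sum_single_one] at h
  refine ⟨S, Z, ⟨hZ, ?_⟩, ?_, ?_⟩
  · split_ifs at h <;> linarith
  · by_contra hi; rw [if_neg hi] at h; split_ifs at h <;> linarith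
  · intro hj; rw [if_pos hj] at h; split_ifs at h <;> linarith

theorem not_feas_tight' {v : ι → Finset γ → ℕ} {x : ι → ℤ} (hx : Feas M v x) (i : ι)
    (h : ¬ Feas M v (x + Pi.single i 1)) :
    ∃ S Z, Tight M v x S Z ∧ i ∈ S := by
  unfold Feas at h
  push Not at h
  obtain ⟨S, Z, hZ, h⟩ := h
  have := hx S Z hZ
  simp only [Pi.add_apply, sum_add_distrib, sum_single_one] at h
  refine ⟨S, Z, ⟨hZ, ?_⟩, ?_⟩
  · split_ifs at h <;> linarith
  · by_contra hi; rw [if_neg hi] at h; linarith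

theorem exchange {v : ι → Finset γ → ℕ} (hv : ∀ i, MatroidRank M (v i)) {x y : ι → ℤ}
    (hx : Feas M v x) (hy : Feas M v y) (i : ι) (hi : y i < x i) :
    Feas M v (y + Pi.single i 1) ∨ ∃ j, x j < y j ∧
      Feas M v (y + Pi.single i 1 - Pi.single j 1) ∧
      Feas M v (x + Pi.single j 1 - Pi.single i 1) := by
  by_contra hcon
  push Not at hcon
  obtain ⟨h0, hcon⟩ := hcon
  have hD : ∀ J : Finset ι, (∀ j ∈ J, ¬ Feas M v (y + Pi.single i 1 - Pi.single j 1)) →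
      ∃ S Z, Tight M v y S Z ∧ i ∈ S ∧ ∀ j ∈ J, j ∉ S := by
    intro J
    induction J using Finset.induction_on with
    | empty =>
      intro _
      obtain ⟨S, Z, h, h'⟩ := not_feas_tight' hy i h0
      exact ⟨S, Z, h, h', by simp⟩
    | insert a J ha ih =>
      intro h
      obtain ⟨S, Z, h1, h2, h3⟩ := ih fun j hj => h j (mem_insert_of_mem hj)
      obtain ⟨T, W, h4, h5, h6⟩ := not_feas_tight hy i a (h a (mem_insert_self _ _))
      refine ⟨_, _, (tight_lattice hv hy h1 h4).2, mem_inter.2 ⟨h2, h5⟩, ?_⟩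
      intro j hj hj'
      rw [mem_inter] at hj'
      rcases mem_insert.1 hj with rfl | hj
      · exact h6 hj'.2
      · exact h3 j hj hj'.1
  have hT : ∀ J : Finset ι, (∀ j ∈ J, ¬ Feas M v (x + Pi.single j 1 - Pi.single i 1)) →
      ∃ S Z, Tight M v x S Z ∧ i ∉ S ∧ ∀ j ∈ J, j ∈ S := by
    intro J
    induction J using Finset.induction_on with
    | empty =>
      intro _
      exact ⟨∅, M, ⟨Subset.refl _, by simp⟩, by simp, by simp⟩
    | insert a J ha ih =>
      intro h
      obtain ⟨S, Z, h1, h2, h3⟩ := ih fun j hj => h j (mem_insert_of_mem hj)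
      obtain ⟨T, W, h4, h5, h6⟩ := not_feas_tight hx a i (h a (mem_insert_self _ _))
      refine ⟨_, _, (tight_lattice hv hx h1 h4).1, by simp [h2, h6], ?_⟩
      intro j hj
      rcases mem_insert.1 hj with rfl | hj
      · exact mem_union_right _ h5
      · exact mem_union_left _ (h3 j hj)
  classical
  obtain ⟨D, Z, ⟨hZ, hDt⟩, hiD, hDJ⟩ := hD
    (univ.filter fun j => ¬ Feas M v (y + Pi.single i 1 - Pi.single j 1)) (by simp)
  obtain ⟨T, W, ⟨hW, hTt⟩, hiT, hTJ⟩ := hT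
    (univ.filter fun j => ¬ Feas M v (x + Pi.single j 1 - Pi.single i 1)) (by simp)
  have hs := rho_submod hv D T hZ hW
  have a := hx (D ∪ T) (Z ∩ W) (inter_subset_left.trans hZ)
  have b := hy (D ∩ T) (Z ∪ W) (union_subset hZ hW)
  have e1 : ∑ k ∈ D ∪ T, x k = ∑ k ∈ D \ T, x k + ∑ k ∈ T, x k := by
    rw [← sdiff_union_self_eq_union, sum_union sdiff_disjoint]
  have e2 : ∑ k ∈ D, y k = ∑ k ∈ D \ T, y k + ∑ k ∈ D ∩ T, y k := by
    rw [← sum_union (disjoint_sdiff_inter D T), sdiff_union_inter]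
  have lt : ∑ k ∈ D \ T, y k < ∑ k ∈ D \ T, x k := by
    apply sum_lt_sum
    · intro j hj
      rw [mem_sdiff] at hj
      by_contra hlt
      push Not at hlt
      by_cases hf : Feas M v (y + Pi.single i 1 - Pi.single j 1)
      · exact hj.2 (hTJ j (by simpa using hcon j hlt hf))
      · exact hDJ j (by simpa using hf) hj.1
    · exact ⟨i, mem_sdiff.2 ⟨hiD, hiT⟩, hi⟩
  linarith

end Feas

section Opt

variable {γ : Type} {n : ℕ} {M : Finset γ} {w : Fin n → ℝ} {v : Fin n → Finset γ → ℕ}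
  {f : ℕ → EReal}

theorem f_ne_bot (hf : StrictMono f) {k : ℕ} (hk : 0 < k) : f k ≠ ⊥ :=
  ne_bot_of_gt (hf hk)

/-- Real-valued welfare of the agents in `S`. -/
noncomputable def WS {n : ℕ} (f : ℕ → EReal) (w : Fin n → ℝ) (S : Finset (Fin n))
    (u : Fin n → ℕ) : ℝ := ∑ k ∈ S, w k * (f (u k)).toReal

theorem sum_eq_WS (hftop : ∀ k, f k ≠ ⊤) (S : Finset (Fin n)) (u : Fin n → ℕ)
    (h : ∀ k ∈ S, f (u k) ≠ ⊥) :
    ∑ k ∈ S, (w k : EReal) * f (u k) = ((WS f w S u : ℝ) : EReal) := by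
  unfold WS
  induction S using Finset.induction_on with
  | empty => simp
  | insert a S ha ih =>
    rw [sum_insert ha, sum_insert ha, ih fun k hk => h k (mem_insert_of_mem hk), EReal.coe_add,
      EReal.coe_mul, EReal.coe_toReal (hftop _) (h a (mem_insert_self _ _))]

theorem welfare_eq (hftop : ∀ k, f k ≠ ⊤) (A : Fin n → Finset γ)
    (h : ∀ k, f (v k (A k)) ≠ ⊥) :
    Welfare n w v f A = ((WS f w univ (fun k => v k (A k)) : ℝ) : EReal) :=
  sum_eq_WS hftop univ (fun k => v k (A k)) fun k _ => h k

theorem rwelfare_eq (hf : StrictMono f) (hftop : ∀ k, f k ≠ ⊤) (A : Fin n → Finset γ) :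
    RWelfare n w v f A = ((WS f w (PosAgents n v A) (fun k => v k (A k)) : ℝ) : EReal) :=
  sum_eq_WS hftop _ (fun k => v k (A k)) fun k hk => f_ne_bot hf (by simpa [PosAgents] using hk)

theorem welfare_ne_bot (hw : ∀ i, 0 < w i) (hf : StrictMono f) (hftop : ∀ k, f k ≠ ⊤)
    (h0 : f 0 = ⊥) (A : Fin n → Finset γ) :
    Welfare n w v f A ≠ ⊥ ↔ PosAgents n v A = univ := by
  constructor
  · intro h
    by_contra hp
    apply h
    have : ∃ k, v k (A k) = 0 := by
      by_contra hc
      push Not at hc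
      exact hp (by ext k; simpa [PosAgents] using Nat.pos_of_ne_zero (hc k))
    obtain ⟨k, hk⟩ := this
    unfold Welfare
    rw [← add_sum_erase univ _ (mem_univ k), hk, h0, EReal.coe_mul_bot_of_pos (hw k),
      EReal.bot_add]
  · intro h
    rw [welfare_eq hftop]
    · exact EReal.coe_ne_bot _
    · intro k
      have : k ∈ PosAgents n v A := h ▸ mem_univ k
      exact f_ne_bot hf (by simpa [PosAgents] using this)

theorem welfare_rwelfare (A : Fin n → Finset γ) (h : PosAgents n v A = univ) :
    Welfare n w v f A = RWelfare n w v f A := by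
  unfold Welfare RWelfare; rw [h]

theorem isRf_fin (hf : StrictMono f) (hftop : ∀ k, f k ≠ ⊤)
    (h0 : f 0 ≠ ⊥) (A : Fin n → Finset γ) :
    IsRf n M w v f A ↔ IsAlloc n M A ∧ ∀ B, IsAlloc n M B →
      WS f w univ (fun k => v k (B k)) ≤ WS f w univ (fun k => v k (A k)) := by
  have hall : ∀ k, f k ≠ ⊥ := fun k => by
    rcases Nat.eq_zero_or_pos k with rfl | hk
    · exact h0
    · exact f_ne_bot hf hk
  have hW : ∀ B : Fin n → Finset γ, Welfare n w v f B = _ :=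
    fun B => welfare_eq hftop B fun k => hall _
  have hne : ∀ B : Fin n → Finset γ, Welfare n w v f B ≠ ⊥ := fun B => by
    rw [hW]; exact EReal.coe_ne_bot _
  constructor
  · rintro ⟨h1, h2, -⟩
    refine ⟨h1, fun B hB => ?_⟩
    have := h2 ⟨A, h1, hne A⟩ B hB
    rw [hW, hW] at this
    exact_mod_cast this
  · rintro ⟨h1, h2⟩
    refine ⟨h1, fun _ B hB => ?_, fun h => absurd (h A h1) (hne A)⟩
    rw [hW, hW]
    exact_mod_cast h2 B hB

theorem isRf_bot (hw : ∀ i, 0 < w i) (hf : StrictMono f) (hftop : ∀ k, f k ≠ ⊤)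
    (h0 : f 0 = ⊥) (A : Fin n → Finset γ) :
    IsRf n M w v f A ↔ IsAlloc n M A ∧ ∀ B, IsAlloc n M B →
      ((PosAgents n v B).card < (PosAgents n v A).card ∨
        ((PosAgents n v B).card = (PosAgents n v A).card ∧
          LexLE (PosAgents n v A) (PosAgents n v B))) ∧
      (PosAgents n v B = PosAgents n v A →
        WS f w (PosAgents n v B) (fun k => v k (B k)) ≤
          WS f w (PosAgents n v A) (fun k => v k (A k))) := by
  have hR : ∀ B : Fin n → Finset γ, RWelfare n w v f B = _ := fun B => rwelfare_eq hf hftop B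
  have hR' : ∀ B : Fin n → Finset γ, (WS f w (PosAgents n v B) (fun k => v k (B k)) ≤
          WS f w (PosAgents n v A) (fun k => v k (A k))) ↔ RWelfare n w v f B ≤ RWelfare n w v f A := by
    intro B; rw [hR, hR]; exact EReal.coe_le_coe_iff.symm
  simp only [hR']
  by_cases hex : ∃ B, IsAlloc n M B ∧ Welfare n w v f B ≠ ⊥
  · have hno : ¬ ∀ B, IsAlloc n M B → Welfare n w v f B = ⊥ := by push Not; exact hex
    constructor
    · rintro ⟨h1, h2, -⟩
      have h2 := h2 hex
      obtain ⟨B0, hB0, hB0'⟩ := hex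
      have hAu : PosAgents n v A = univ := by
        rw [← welfare_ne_bot hw hf hftop h0]
        intro h
        have := h2 B0 hB0
        rw [h] at this
        exact hB0' (le_bot_iff.1 this)
      refine ⟨h1, fun B hB => ⟨?_, ?_⟩⟩
      · rcases (card_le_univ (PosAgents n v B)).lt_or_eq with h | h
        · left; rw [hAu]; simpa using h
        · right
          have : PosAgents n v B = univ := card_eq_iff_eq_univ _ |>.1 h
          rw [this, hAu]; exact ⟨rfl, Or.inl rfl⟩
      · intro h
        rw [← welfare_rwelfare A hAu, ← welfare_rwelfare B (h.trans hAu)]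
        exact h2 B hB
    · rintro ⟨h1, h2⟩
      refine ⟨h1, fun _ B hB => ?_, fun h => absurd h hno⟩
      obtain ⟨B0, hB0, hB0'⟩ := hex
      rw [welfare_ne_bot hw hf hftop h0] at hB0'
      have hAu : PosAgents n v A = univ := by
        have h := (h2 B0 hB0).1
        rw [hB0'] at h
        have := card_le_univ (PosAgents n v A)
        rw [← card_eq_iff_eq_univ]
        rw [card_univ] at h
        omega
      by_cases hBu : Welfare n w v f B = ⊥
      · rw [hBu]; exact bot_le
      · have hBu := (welfare_ne_bot hw hf hftop h0 B).1 hBu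
        rw [welfare_rwelfare A hAu, welfare_rwelfare B hBu]
        exact (h2 B hB).2 (hBu.trans hAu.symm)
  · have hall : ∀ B, IsAlloc n M B → Welfare n w v f B = ⊥ := by
      intro B hB; by_contra h; exact hex ⟨B, hB, h⟩
    exact ⟨fun h => ⟨h.1, h.2.2 hall⟩, fun h => ⟨h.1, fun h' => absurd h' hex, fun _ => h.2⟩⟩

theorem WS_single {S : Finset (Fin n)} {i : Fin n} (hi : i ∈ S) {a b : Fin n → ℕ}
    (h : ∀ k, k ≠ i → b k = a k) :
    WS f w S b = WS f w S a + w i * ((f (b i)).toReal - (f (a i)).toReal) := by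
  unfold WS
  rw [← add_sum_erase S _ hi, ← add_sum_erase S (fun k => w k * (f (a k)).toReal) hi]
  have : ∑ k ∈ S.erase i, w k * (f (b k)).toReal = ∑ k ∈ S.erase i, w k * (f (a k)).toReal :=
    sum_congr rfl fun k hk => by rw [h k (ne_of_mem_erase hk)]
  rw [this]; ring

theorem WS_double {S : Finset (Fin n)} {i j : Fin n} (hi : i ∈ S) (hj : j ∈ S) (hij : i ≠ j)
    {a b : Fin n → ℕ} (h : ∀ k, k ≠ i → k ≠ j → b k = a k) :
    WS f w S b = WS f w S a + w i * ((f (b i)).toReal - (f (a i)).toReal)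
      - w j * ((f (a j)).toReal - (f (b j)).toReal) := by
  rw [WS_single hi (a := Function.update a j (b j)) (b := b), WS_single hj (a := a)]
  · simp [hij]; ring
  · intro k hk; simp [hk]
  · intro k hk
    by_cases hkj : k = j
    · subst hkj; simp
    · simp [hkj, h k hk hkj]

theorem toReal_lt (hf : StrictMono f) (hftop : ∀ k, f k ≠ ⊤) {k l : ℕ} (h : f k ≠ ⊥)
    (hkl : k < l) : (f k).toReal < (f l).toReal := by
  have := hf hkl
  rw [← EReal.coe_toReal (hftop k) h, ← EReal.coe_toReal (hftop l) (ne_bot_of_gt this)] at this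
  exact_mod_cast this

theorem opt_single (hw : ∀ i, 0 < w i) (hf : StrictMono f) (hftop : ∀ k, f k ≠ ⊤)
    {A B : Fin n → Finset γ} (hA : IsRf n M w v f A) (hB : IsAlloc n M B) (i : Fin n)
    (hi : v i (B i) = v i (A i) + 1) (hk : ∀ k, k ≠ i → v k (B k) = v k (A k)) : False := by
  by_cases h0 : f 0 = ⊥
  · rw [isRf_bot hw hf hftop h0] at hA
    obtain ⟨h1, h2⟩ := hA.2 B hB
    have hiB : i ∈ PosAgents n v B := by simp [PosAgents, hi]
    by_cases hz : v i (A i) = 0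
    · have : (PosAgents n v A).card < (PosAgents n v B).card := by
        apply card_lt_card
        rw [ssubset_iff_of_subset]
        · exact ⟨i, hiB, by simp [PosAgents, hz]⟩
        · intro k
          by_cases h : k = i
          · subst h; simp [PosAgents, hz]
          · simp [PosAgents, hk k h]
      omega
    · have e : PosAgents n v B = PosAgents n v A := by
        ext k
        by_cases h : k = i
        · subst h; simp [PosAgents, hi]; omega
        · simp [PosAgents, hk k h]
      have h2 := h2 e
      rw [e, WS_single (e ▸ hiB) hk, hi] at h2
      have := mul_pos (hw i) (sub_pos.2 (toReal_lt hf hftop (f_ne_bot hf (Nat.pos_of_ne_zero hz))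
        (Nat.lt_succ_self (v i (A i)))))
      simp only [Nat.succ_eq_add_one] at this
      linarith
  · rw [isRf_fin hf hftop h0] at hA
    have h2 := hA.2 B hB
    rw [WS_single (mem_univ i) hk, hi] at h2
    have hne : f (v i (A i)) ≠ ⊥ := by
      rcases Nat.eq_zero_or_pos (v i (A i)) with h | h
      · rwa [h]
      · exact f_ne_bot hf h
    have := mul_pos (hw i) (sub_pos.2 (toReal_lt hf hftop hne
        (Nat.lt_succ_self (v i (A i)))))
    simp only [Nat.succ_eq_add_one] at this
    linarith

theorem lex_contra {A B : Fin n → Finset γ} (hA : IsRfTie n M w v f A) (hB : IsRf n M w v f B)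
    {i j : Fin n} (hij : i ≠ j)
    (hi : v i (B i) = v i (A i) + 1)
    (hk : ∀ k, k ≠ i → k ≠ j → v k (B k) = v k (A k)) : j < i := by
  by_contra h
  have h : i < j := lt_of_le_of_ne (not_lt.1 h) hij
  refine hA.2.1 B hB ⟨i, ?_, fun k hki => ?_⟩
  · simp only; omega
  · exact (hk k hki.ne (hki.trans h).ne).symm

theorem opt_double (hw : ∀ i, 0 < w i) (hf : StrictMono f) (hftop : ∀ k, f k ≠ ⊤)
    {A B : Fin n → Finset γ} (hA : IsRfTie n M w v f A) (hB : IsAlloc n M B) {i j : Fin n}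
    (hij : i ≠ j) (hi : v i (B i) = v i (A i) + 1) (hj : v j (A j) = v j (B j) + 1)
    (hk : ∀ k, k ≠ i → k ≠ j → v k (B k) = v k (A k)) :
    ((f 0 ≠ ⊥ ∨ (0 < v i (A i) ∧ 0 < v j (B j))) →
      w i * ((f (v i (A i) + 1)).toReal - (f (v i (A i))).toReal) ≤
        w j * ((f (v j (B j) + 1)).toReal - (f (v j (B j))).toReal) ∧
      (w i * ((f (v i (A i) + 1)).toReal - (f (v i (A i))).toReal) =
        w j * ((f (v j (B j) + 1)).toReal - (f (v j (B j))).toReal) → j < i)) ∧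
    (f 0 = ⊥ → v i (A i) = 0 → v j (B j) = 0 ∧ j < i) := by
  have hR := hA.1
  by_cases h0 : f 0 = ⊥
  · rw [isRf_bot hw hf hftop h0] at hR
    obtain ⟨h1, h2⟩ := hR.2 B hB
    have hiB : i ∈ PosAgents n v B := by simp [PosAgents, hi]
    have hjA : j ∈ PosAgents n v A := by simp [PosAgents, hj]
    constructor
    · rintro (h | ⟨hi0, hj0⟩)
      · exact absurd h0 h
      have e : PosAgents n v B = PosAgents n v A := by
        ext k
        by_cases h : k = i
        · subst h; simp [PosAgents, hi]; omega
        · by_cases h' : k = j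
          · subst h'; simp [PosAgents, hj]; omega
          · simp [PosAgents, hk k h h']
      have h2 := h2 e
      have hd := WS_double (f := f) (w := w) (e ▸ hiB) hjA hij hk
      simp only [hi, hj] at hd
      rw [e, hd] at h2
      refine ⟨by linarith, fun heq => ?_⟩
      refine lex_contra hA ?_ hij hi hk
      rw [isRf_bot hw hf hftop h0]
      refine ⟨hB, fun C hC => ?_⟩
      have := hR.2 C hC
      rw [e, hd, heq, add_sub_cancel_right]
      exact this
    · intro _ hz
      have hiA : i ∉ PosAgents n v A := by simp [PosAgents, hz]
      have hjz : v j (B j) = 0 := by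
        by_contra hjz
        have : (PosAgents n v A).card < (PosAgents n v B).card := by
          apply card_lt_card
          rw [ssubset_iff_of_subset]
          · exact ⟨i, hiB, hiA⟩
          · intro k
            by_cases h : k = i
            · subst h; simp [PosAgents, hz]
            · by_cases h' : k = j
              · subst h'; intro _; simp [PosAgents]; omega
              · simp [PosAgents, hk k h h']
        omega
      refine ⟨hjz, ?_⟩
      have hjB : j ∉ PosAgents n v B := by simp [PosAgents, hjz]
      have hother : ∀ k, k ≠ i → k ≠ j → (k ∈ PosAgents n v B ↔ k ∈ PosAgents n v A) := by
        intro k h h'; simp [PosAgents, hk k h h']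
      have e : PosAgents n v B = insert i ((PosAgents n v A).erase j) := by
        ext k
        by_cases h : k = i
        · subst h; simp [hiB]
        · by_cases h' : k = j
          · subst h'; simp [h, hjB]
          · simp [h, h', hother k h h']
      have hc : (PosAgents n v B).card = (PosAgents n v A).card := by
        rw [e, card_insert_of_notMem (by simp [hiA]), card_erase_add_one hjA]
      rcases h1 with h1 | ⟨-, h1 | ⟨t, htA, htB, ht⟩⟩
      · omega
      · exact absurd (h1 ▸ hiB) hiA
      · have hti : t ≠ i := fun h => hiA (h ▸ htA)
        have htj : t = j := by
          by_contra h
          exact htB ((hother t hti h).2 htA)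
        subst htj
        by_contra hlt
        have := ht i (lt_of_le_of_ne (not_lt.1 hlt) hij)
        exact hiA (this.2 hiB)
  · refine ⟨fun _ => ?_, fun h => absurd h h0⟩
    rw [isRf_fin hf hftop h0] at hR
    have h2 := hR.2 B hB
    have hd := WS_double (f := f) (w := w) (mem_univ i) (mem_univ j) hij hk
    simp only [hi, hj] at hd
    rw [hd] at h2
    refine ⟨by linarith, fun heq => ?_⟩
    refine lex_contra hA ?_ hij hi hk
    rw [isRf_fin hf hftop h0]
    refine ⟨hB, fun C hC => ?_⟩
    have := hR.2 C hC
    rw [hd, heq, add_sub_cancel_right]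
    exact this

theorem conc_step (hf : StrictMono f) (hftop : ∀ k, f k ≠ ⊤)
    (hconc : ∀ k : ℕ, f (k + 2) + f k ≤ f (k + 1) + f (k + 1)) {k m : ℕ} (hk : f k ≠ ⊥)
    (hkm : k ≤ m) :
    (f (m + 1)).toReal - (f m).toReal ≤ (f (k + 1)).toReal - (f k).toReal := by
  induction m, hkm using Nat.le_induction with
  | base => exact le_refl _
  | succ m hm ih =>
    have hb : f m ≠ ⊥ := by
      rcases hm.eq_or_lt with h | h
      · rwa [← h]
      · exact ne_bot_of_gt (hf h)
    have hb1 : f (m + 1) ≠ ⊥ := f_ne_bot hf (Nat.succ_pos _)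
    have hb2 : f (m + 2) ≠ ⊥ := f_ne_bot hf (Nat.succ_pos _)
    have := hconc m
    rw [← EReal.coe_toReal (hftop m) hb, ← EReal.coe_toReal (hftop _) hb1,
      ← EReal.coe_toReal (hftop _) hb2, ← EReal.coe_add, ← EReal.coe_add,
      EReal.coe_le_coe_iff] at this
    linarith

end Opt

theorem feas_single_alloc {γ : Type} [DecidableEq γ] {M : Finset γ} {n : ℕ}
    {v : Fin n → Finset γ → ℕ} (hv : ∀ i, MatroidRank M (v i)) {a : Fin n → ℕ} {i : Fin n}
    (h : Feas M v ((fun k => (a k : ℤ)) + Pi.single i 1)) :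
    ∃ B, IsAlloc n M B ∧ v i (B i) = a i + 1 ∧ ∀ k, k ≠ i → v k (B k) = a k := by
  obtain ⟨B, h1, h2, h3⟩ := feas_to_alloc hv (Function.update a i (a i + 1)) (by
    convert h using 1
    funext k
    by_cases hk : k = i
    · subst hk; simp
    · simp [hk])
  refine ⟨B, ⟨h1, h2⟩, by simp [h3], fun k hk => by simp [h3, hk]⟩

theorem feas_double_alloc {γ : Type} [DecidableEq γ] {M : Finset γ} {n : ℕ}
    {v : Fin n → Finset γ → ℕ} (hv : ∀ i, MatroidRank M (v i)) {a : Fin n → ℕ} {i j : Fin n}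
    (hij : i ≠ j) (hj : 0 < a j)
    (h : Feas M v ((fun k => (a k : ℤ)) + Pi.single i 1 - Pi.single j 1)) :
    ∃ B, IsAlloc n M B ∧ v i (B i) = a i + 1 ∧ a j = v j (B j) + 1 ∧
      ∀ k, k ≠ i → k ≠ j → v k (B k) = a k := by
  obtain ⟨B, h1, h2, h3⟩ := feas_to_alloc hv
    (Function.update (Function.update a i (a i + 1)) j (a j - 1)) (by
    convert h using 1
    funext k
    by_cases hk : k = j
    · subst hk; simp [hij.symm]; omega
    · by_cases hk' : k = i
      · subst hk'; simp [hk]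
      · simp [hk, hk'])
  refine ⟨B, ⟨h1, h2⟩, by simp [h3, hij], by simp [h3]; omega, fun k hk hk' => by simp [h3, hk, hk']⟩

/-- Population-monotonicity of `R^tie_f` for a strictly increasing concave `f` under
matroid-rank valuations: adding an extra agent (the original agents keeping their weights,
valuations, and relative order, witnessed by the order embedding `φ`) never increases the
utility of any original agent. -/
theorem populationMonotonicity {γ : Type} [DecidableEq γ] {n : ℕ} (M : Finset γ)
    (w : Fin n → ℝ) (hw : ∀ i, 0 < w i)
    (v : Fin n → Finset γ → ℕ) (hv : ∀ i, MatroidRank M (v i))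
    (f : ℕ → EReal) (hf : StrictMono f) (hftop : ∀ k, f k ≠ ⊤)
    (hconc : ∀ k : ℕ, f (k + 2) + f k ≤ f (k + 1) + f (k + 1))
    (φ : Fin n ↪o Fin (n + 1))
    (w' : Fin (n + 1) → ℝ) (hw' : ∀ i, 0 < w' i)
    (v' : Fin (n + 1) → Finset γ → ℕ) (hv' : ∀ i, MatroidRank M (v' i))
    (hwφ : ∀ i : Fin n, w' (φ i) = w i) (hvφ : ∀ i : Fin n, v' (φ i) = v i)
    (A : Fin n → Finset γ) (A' : Fin (n + 1) → Finset γ)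
    (hA : IsRfTie n M w v f A) (hA' : IsRfTie (n + 1) M w' v' f A') :
    ∀ i : Fin n, v i (A' (φ i)) ≤ v i (A i) := by

  intro i0
  by_contra hlt
  push Not at hlt
  have hinj := φ.injective
  set A0 : Fin (n + 1) → Finset γ := Function.extend φ A (fun _ => ∅) with hA0
  have hA0φ : ∀ i, A0 (φ i) = A i := fun i => hinj.extend_apply A _ i
  have hA0n : ∀ k, (¬ ∃ i, φ i = k) → A0 k = ∅ := fun k hk => Function.extend_apply' A _ k hk
  have hal : IsAlloc (n + 1) M A0 := by
    constructor
    · intro k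
      by_cases hk : ∃ i, φ i = k
      · obtain ⟨i, rfl⟩ := hk
        rw [hA0φ]; exact hA.1.1.1 i
      · rw [hA0n k hk]; exact empty_subset _
    · intro k l hkl
      by_cases hk : ∃ i, φ i = k
      · by_cases hl : ∃ i, φ i = l
        · obtain ⟨i, rfl⟩ := hk
          obtain ⟨j, rfl⟩ := hl
          rw [hA0φ, hA0φ]
          exact hA.1.1.2 i j fun h => hkl (h ▸ rfl)
        · rw [hA0n l hl]; exact disjoint_empty_right _
      · rw [hA0n k hk]; exact disjoint_empty_left _
  have hres : ∀ B, IsAlloc (n + 1) M B → IsAlloc n M (fun i => B (φ i)) := fun B hB =>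
    ⟨fun i => hB.1 _, fun i j hij => hB.2 _ _ fun h => hij (hinj h)⟩
  have hy := alloc_to_feas hv' A0 hal.1 hal.2
  have hx := alloc_to_feas hv' A' hA'.1.1.1 hA'.1.1.2
  have hAv : ∀ i, v' (φ i) (A0 (φ i)) = v i (A i) := fun i => by rw [hA0φ, hvφ]
  rcases exchange hv' hx hy (φ i0) (by rw [hAv, hvφ]; exact_mod_cast hlt) with
    h | ⟨j, hj, h1, h2⟩
  · obtain ⟨B, hB, hBi, hBk⟩ := feas_single_alloc hv' (a := fun k => v' k (A0 k)) h
    refine opt_single hw hf hftop hA.1 (hres B hB) i0 ?_ fun k hk => ?_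
    · simpa only [hAv, hvφ] using hBi
    · simpa only [hAv, hvφ] using hBk (φ k) fun h => hk (hinj h)
  · simp only [Nat.cast_lt] at hj
    obtain ⟨j0, rfl⟩ : ∃ j0, φ j0 = j := by
      by_contra hn
      rw [hA0n j hn, (hv' j).2.2.2] at hj
      omega
    have hlt' : v i0 (A i0) < v' (φ i0) (A' (φ i0)) := by rw [hvφ]; exact hlt
    have hij : i0 ≠ j0 := by
      rintro rfl
      rw [hAv] at hj
      omega
    have hij' : φ i0 ≠ φ j0 := fun h => hij (hinj h)
    obtain ⟨B, hB, hBi, hBj, hBk⟩ := feas_double_alloc hv' (a := fun k => v' k (A0 k)) hij'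
      (by omega) h1
    obtain ⟨C, hC, hCj, hCi, hCk⟩ := feas_double_alloc hv' (a := fun k => v' k (A' k)) hij'.symm
      (by omega) h2
    simp only [hAv] at hBi hBj hj
    have hBi' : v i0 (B (φ i0)) = v i0 (A i0) + 1 := by rw [← hBi, hvφ]
    have hBj' : v j0 (A j0) = v j0 (B (φ j0)) + 1 := by rw [hBj, hvφ]
    obtain ⟨p1, p2⟩ := opt_double hw hf hftop hA (hres B hB) hij hBi' hBj' (fun k hk hk' => by
      simpa only [hAv, hvφ] using hBk (φ k) (fun h => hk (hinj h)) (fun h => hk' (hinj h)))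
    obtain ⟨q1, q2⟩ := opt_double hw' hf hftop hA' hC hij'.symm hCj hCi hCk
    have key : (f 0 ≠ ⊥ ∨ (0 < v i0 (A i0) ∧ 0 < v' (φ j0) (A' (φ j0)))) → False := by
      intro hpos
      have hfin : ∀ k, (f 0 ≠ ⊥ ∨ 0 < k) → f k ≠ ⊥ := by
        rintro k (h | h)
        · rcases Nat.eq_zero_or_pos k with rfl | hk
          · exact h
          · exact f_ne_bot hf hk
        · exact f_ne_bot hf h
      obtain ⟨p1, p3⟩ := p1 (hpos.imp_right fun h => ⟨h.1, by omega⟩)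
      obtain ⟨q1, q3⟩ := q1 (hpos.imp_right fun h => ⟨h.2, by omega⟩)
      rw [hwφ, hwφ] at q1 q3
      have c1 := mul_le_mul_of_nonneg_left (conc_step hf hftop hconc
        (k := v i0 (A i0)) (m := v' (φ i0) (C (φ i0)))
        (hfin _ (hpos.imp_right fun h => h.1)) (by omega)) (hw i0).le
      have c2 := mul_le_mul_of_nonneg_left (conc_step hf hftop hconc
        (k := v' (φ j0) (A' (φ j0))) (m := v j0 (B (φ j0)))
        (hfin _ (hpos.imp_right fun h => h.2)) (by omega)) (hw j0).le
      have l1 := p3 (by linarith)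
      have l2 := q3 (by linarith)
      rw [OrderEmbedding.lt_iff_lt] at l2
      exact lt_asymm l1 l2
    by_cases h0 : f 0 = ⊥
    · by_cases hz : v i0 (A i0) = 0
      · obtain ⟨r1, r2⟩ := p2 h0 hz
        obtain ⟨s1, s2⟩ := q2 h0 (by omega)
        rw [OrderEmbedding.lt_iff_lt] at s2
        exact lt_asymm r2 s2
      · by_cases hz' : v' (φ j0) (A' (φ j0)) = 0
        · obtain ⟨s1, s2⟩ := q2 h0 hz'
          omega
        · exact key (Or.inr ⟨by omega, by omega⟩)
    · exact key (Or.inl h0)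
end

section
/- Let f be strictly increasing and let all agents have matroid-rank valuations. Let I be an instance with agents N and weights (w_1,…,w_n), and let I' be obtained from I by increasing the weight of a single agent i ∈ N to w'_i > w_i while keeping all other weights, the goods, and the valuations unchanged. If A is an R^tie_f allocation of I and A' is an R^tie_f allocation of I', then v_i(A_i) ≤ v_i(A'_i). (That is, the rule R^tie_f is weight-monotone.) -/
open Finset

theorem sum_coe_aux {n : ℕ} (s : Finset (Fin n)) (w : Fin n → ℝ) (a : Fin n → EReal)
    (ha : ∀ i ∈ s, a i ≠ ⊥) (ha' : ∀ i ∈ s, a i ≠ ⊤) :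
    ∑ i ∈ s, (w i : EReal) * a i = ((∑ i ∈ s, w i * (a i).toReal : ℝ) : EReal) := by
  induction s using Finset.induction_on with
  | empty => simp
  | insert x s hx ih =>
    rw [Finset.sum_insert hx, Finset.sum_insert hx, EReal.coe_add, EReal.coe_mul,
      EReal.coe_toReal (ha' x (by simp)) (ha x (by simp)),
      ih (fun i hi => ha i (by simp [hi])) (fun i hi => ha' i (by simp [hi]))]

theorem core_aux {n : ℕ} (s : Finset (Fin n)) (w w' : Fin n → ℝ) (a b : Fin n → EReal)
    (i0 : Fin n) (hi0 : i0 ∈ s)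
    (hincr : w i0 < w' i0) (hsame : ∀ k : Fin n, k ≠ i0 → w' k = w k)
    (ha : ∀ i ∈ s, a i ≠ ⊥) (ha' : ∀ i ∈ s, a i ≠ ⊤)
    (hb : ∀ i ∈ s, b i ≠ ⊥) (hb' : ∀ i ∈ s, b i ≠ ⊤)
    (h1 : ∑ i ∈ s, (w i : EReal) * b i ≤ ∑ i ∈ s, (w i : EReal) * a i)
    (h2 : ∑ i ∈ s, (w' i : EReal) * a i ≤ ∑ i ∈ s, (w' i : EReal) * b i) :
    a i0 ≤ b i0 := by
  rw [sum_coe_aux s _ a ha ha', sum_coe_aux s _ b hb hb', EReal.coe_le_coe_iff] at h1 h2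
  have e : ∀ c : Fin n → ℝ, ∑ i ∈ s.erase i0, w' i * c i = ∑ i ∈ s.erase i0, w i * c i := by
    intro c
    apply Finset.sum_congr rfl
    intro i hi
    rw [hsame i (Finset.ne_of_mem_erase hi)]
  simp only [← Finset.add_sum_erase s _ hi0] at h1 h2
  rw [e (fun i => (a i).toReal), e (fun i => (b i).toReal)] at h2
  rw [← EReal.coe_toReal (ha' i0 hi0) (ha i0 hi0), ← EReal.coe_toReal (hb' i0 hi0) (hb i0 hi0),
    EReal.coe_le_coe_iff]
  by_contra hlt
  push Not at hlt
  nlinarith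

theorem welfare_ne_bot_iff {γ : Type} {n : ℕ} (w : Fin n → ℝ) (hw : ∀ i, 0 < w i)
    (v : Fin n → Finset γ → ℕ) (f : ℕ → EReal) (hftop : ∀ k, f k ≠ ⊤)
    (A : Fin n → Finset γ) :
    Welfare n w v f A ≠ ⊥ ↔ ∀ i, f (v i (A i)) ≠ ⊥ := by
  constructor
  · intro h i hi
    apply h
    unfold Welfare
    rw [← Finset.add_sum_erase _ _ (Finset.mem_univ i), hi, EReal.coe_mul_bot_of_pos (hw i),
      EReal.bot_add]
  · intro h
    unfold Welfare
    rw [sum_coe_aux _ w (fun i => f (v i (A i))) (fun i _ => h i) (fun i _ => hftop _)]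
    exact EReal.coe_ne_bot _

theorem lexLE_antisymm {n : ℕ} {S T : Finset (Fin n)} (h1 : LexLE S T) (h2 : LexLE T S) :
    S = T := by
  rcases h1 with h1 | ⟨i, hi, hi', hij⟩
  · exact h1
  rcases h2 with h2 | ⟨j, hj, hj', hjj⟩
  · exact h2.symm
  rcases lt_trichotomy i j with h | h | h
  · exact absurd ((hjj i h).2 hi) hi'
  · subst h; exact absurd hj hi'
  · exact absurd ((hij j h).2 hj) hj'

/-- Weight-monotonicity of `R^tie_f` for a strictly increasing `f` under matroid-rank
valuations: increasing a single agent's weight never decreases that agent's utility. -/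
theorem weightMonotonicity {γ : Type} [DecidableEq γ] {n : ℕ} (M : Finset γ)
    (v : Fin n → Finset γ → ℕ) (hv : ∀ i, MatroidRank M (v i))
    (f : ℕ → EReal) (hf : StrictMono f) (hftop : ∀ k, f k ≠ ⊤)
    (i0 : Fin n) (w w' : Fin n → ℝ) (hw : ∀ i, 0 < w i)
    (hincr : w i0 < w' i0) (hsame : ∀ k : Fin n, k ≠ i0 → w' k = w k)
    (A A' : Fin n → Finset γ)
    (hA : IsRfTie n M w v f A) (hA' : IsRfTie n M w' v f A') :
    v i0 (A i0) ≤ v i0 (A' i0) := by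
  have hw' : ∀ i, 0 < w' i := by
    intro i
    by_cases h : i = i0
    · subst h; exact (hw i).trans hincr
    · rw [hsame i h]; exact hw i
  obtain ⟨⟨hAa, hA1, hA2⟩, -, -⟩ := hA
  obtain ⟨⟨hAa', hA1', hA2'⟩, -, -⟩ := hA'
  have key := welfare_ne_bot_iff w hw v f hftop
  have key' := welfare_ne_bot_iff w' hw' v f hftop
  by_cases hex : ∃ B, IsAlloc n M B ∧ Welfare n w v f B ≠ ⊥
  · obtain ⟨B, hB, hBw⟩ := hex
    have hBw' := (key' B).2 ((key B).1 hBw)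
    have m := hA1 ⟨B, hB, hBw⟩
    have m' := hA1' ⟨B, hB, hBw'⟩
    have fa := (key A).1 (fun h => hBw (le_bot_iff.1 (h ▸ m B hB)))
    have fa' := (key' A').1 (fun h => hBw' (le_bot_iff.1 (h ▸ m' B hB)))
    exact hf.le_iff_le.1 (core_aux Finset.univ w w' (fun i => f (v i (A i)))
      (fun i => f (v i (A' i))) i0 (Finset.mem_univ _) hincr hsame (fun i _ => fa i)
      (fun i _ => hftop _) (fun i _ => fa' i) (fun i _ => hftop _) (m A' hAa') (m' A hAa))
  · have hb : ∀ B, IsAlloc n M B → Welfare n w v f B = ⊥ := by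
      intro B hB
      by_contra h
      exact hex ⟨B, hB, h⟩
    have hb' : ∀ B, IsAlloc n M B → Welfare n w' v f B = ⊥ := by
      intro B hB
      by_contra h
      exact (key B).2 ((key' B).1 h) (hb B hB)
    obtain ⟨c1, r1⟩ := hA2 hb A' hAa'
    obtain ⟨c2, r2⟩ := hA2' hb' A hAa
    have hS : PosAgents n v A = PosAgents n v A' := by
      rcases c1 with c1 | ⟨c1, l1⟩
      · rcases c2 with c2 | ⟨c2, l2⟩ <;> omega
      · rcases c2 with c2 | ⟨c2, l2⟩
        · omega
        · exact lexLE_antisymm l1 l2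
    by_cases h0 : 0 < v i0 (A i0)
    · have r1 := r1 hS.symm
      have r2 := r2 hS
      unfold RWelfare at r1 r2
      rw [← hS] at r1 r2
      have pos : ∀ k, 0 < k → f k ≠ ⊥ := fun k hk => ((bot_le).trans_lt (hf hk)).ne'
      exact hf.le_iff_le.1 (core_aux (PosAgents n v A) w w' (fun i => f (v i (A i)))
        (fun i => f (v i (A' i))) i0 (by simp [PosAgents, h0]) hincr hsame
        (fun i hi => pos _ (by simpa [PosAgents] using hi))
        (fun i _ => hftop _)
        (fun i hi => pos _ (by rw [hS] at hi; simpa [PosAgents] using hi))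
        (fun i _ => hftop _) r1 r2)
    · omega
end

section
/- Let f be strictly increasing and concave. There do not exist matroid-rank valuation profiles v = (v_1,…,v_n) and v' = (v'_1,…,v'_n) over the same goods, positive weights (w_1,…,w_n), a nonempty set of agents S ⊆ N, an R^tie_f allocation A of the instance with profile v, and an R^tie_f allocation A' of the instance with profile v' (same weights), such that v_j = v'_j for all j ∈ N ∖ S and v_i(A'_i) > v_i(A_i) for all i ∈ S (where utilities are measured by the true valuations v). (That is, the rule R^tie_f is group-strategyproof.) -/
open Finset

lemma mr_insert {γ : Type} [DecidableEq γ] {M : Finset γ} {v : Finset γ → ℕ}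
    (h : MatroidRank M v) {X : Finset γ} (hX : X ⊆ M) {g : γ} (hg : g ∈ M) :
    v (insert g X) = v X ∨ (g ∉ X ∧ v (insert g X) = v X + 1) := by
  by_cases hgX : g ∈ X
  · left; rw [insert_eq_of_mem hgX]
  · rcases h.1 X hX g hg hgX with h1 | h1
    · exact Or.inl h1
    · exact Or.inr ⟨hgX, h1⟩

lemma mr_union_le {γ : Type} [DecidableEq γ] {M : Finset γ} {v : Finset γ → ℕ}
    (h : MatroidRank M v) {X : Finset γ} (hX : X ⊆ M) (Y : Finset γ) :
    Y ⊆ M → v (X ∪ Y) ≤ v X + Y.card := by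
  induction Y using Finset.induction_on with
  | empty => intro _; simp
  | insert g Y hg ih =>
    intro hY
    have hYM : Y ⊆ M := (subset_insert _ _).trans hY
    have hgM : g ∈ M := hY (mem_insert_self _ _)
    have := ih hYM
    rw [union_insert, card_insert_of_notMem hg]
    rcases mr_insert h (union_subset hX hYM) hgM with h1 | ⟨_, h1⟩ <;> omega

lemma mr_le_card {γ : Type} [DecidableEq γ] {M : Finset γ} {v : Finset γ → ℕ}
    (h : MatroidRank M v) {X : Finset γ} (hX : X ⊆ M) : v X ≤ X.card := by
  have := mr_union_le h (empty_subset M) X hX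
  rw [h.2.2.2] at this
  simpa using this

lemma mr_indep_sub {γ : Type} [DecidableEq γ] {M : Finset γ} {v : Finset γ → ℕ}
    (h : MatroidRank M v) {X Y : Finset γ} (hX : X ⊆ M) (hYX : Y ⊆ X) (hi : v X = X.card) :
    v Y = Y.card := by
  have h1 := mr_union_le h (hYX.trans hX) (X \ Y) (sdiff_subset.trans hX)
  rw [union_sdiff_of_subset hYX] at h1
  have h2 := mr_le_card h (hYX.trans hX)
  have h3 := card_sdiff_add_card_eq_card hYX
  omega

lemma mr_aug {γ : Type} [DecidableEq γ] {M : Finset γ} {v : Finset γ → ℕ}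
    (h : MatroidRank M v) {X Y : Finset γ} (hX : X ⊆ M) (hY : Y ⊆ M) (hlt : v X < v Y) :
    ∃ g ∈ Y, g ∉ X ∧ v (insert g X) = v X + 1 := by
  by_contra hcon
  push Not at hcon
  have key : ∀ Z : Finset γ, Z ⊆ Y → v (X ∪ Z) = v X := by
    intro Z
    induction Z using Finset.induction_on with
    | empty => intro _; simp
    | insert g Z hg ih =>
      intro hZ
      have hZY : Z ⊆ Y := (subset_insert _ _).trans hZ
      have hgY : g ∈ Y := hZ (mem_insert_self _ _)
      have e := ih hZY
      rw [union_insert]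
      by_cases hgm : g ∈ X ∪ Z
      · rw [insert_eq_of_mem hgm, e]
      · have hgX : g ∉ X := fun hh => hgm (mem_union_left _ hh)
        have h1 := h.2.2.1 X (X ∪ Z) subset_union_left (union_subset hX (hZY.trans hY)) g
          (hY hgY) hgm
        have h2 := hcon g hgY hgX
        have h3 := h.2.1 (X ∪ Z) (insert g (X ∪ Z)) (subset_insert _ _)
          (insert_subset (hY hgY) (union_subset hX (hZY.trans hY)))
        rcases mr_insert h hX (hY hgY) with h4 | ⟨_, h4⟩ <;> omega
  have h1 := key Y (Subset.refl _)
  have h2 := h.2.1 Y (X ∪ Y) subset_union_right (union_subset hX hY)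
  omega

lemma mr_basis {γ : Type} [DecidableEq γ] {M : Finset γ} {v : Finset γ → ℕ}
    (h : MatroidRank M v) {X : Finset γ} (hX : X ⊆ M) :
    ∃ Y ⊆ X, v Y = Y.card ∧ Y.card = v X := by
  have key : ∀ k ≤ v X, ∃ Y ⊆ X, v Y = Y.card ∧ Y.card = k := by
    intro k
    induction k with
    | zero => intro _; exact ⟨∅, empty_subset _, by simp [h.2.2.2], by simp⟩
    | succ k ih =>
      intro hk
      obtain ⟨Y, hYX, hY1, hY2⟩ := ih (by omega)
      obtain ⟨g, hg, hgY, e⟩ := mr_aug h (hYX.trans hX) hX (by omega : v Y < v X)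
      refine ⟨insert g Y, insert_subset hg hYX, ?_, ?_⟩ <;>
        rw [card_insert_of_notMem hgY] <;> omega
  exact key _ le_rfl

lemma exchange_s11 {γ : Type} [DecidableEq γ] {n : ℕ} {M : Finset γ} {v : Fin n → Finset γ → ℕ}
    (hv : ∀ i, MatroidRank M (v i)) {B : Fin n → Finset γ}
    (hB : IsAlloc n M B) (hBn : NonRedundant n v B) (a : Fin n → ℕ) (i : Fin n)
    (hi : a i < (B i).card) (N : ℕ) :
    ∀ (C : Fin n → Finset γ) (k : Fin n), IsAlloc n M C → NonRedundant n v C →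
    (∀ l, (C l).card + (if l = k then 1 else 0) = a l + (if l = i then 1 else 0)) →
    (∑ l, (C l \ B l).card) < N →
    ∃ D : Fin n → Finset γ, IsAlloc n M D ∧ NonRedundant n v D ∧
      ((∀ l, (D l).card = a l + (if l = i then 1 else 0)) ∨
       ∃ j, j ≠ i ∧ (B j).card < a j ∧
        ∀ l, (D l).card + (if l = j then 1 else 0) = a l + (if l = i then 1 else 0)) := by
  induction N with
  | zero =>
    intro C k hC hCn hs hN
    omega
  | succ N ih =>
    intro C k hC hCn hs hN
    by_cases hdone : k ≠ i ∧ (B k).card < a k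
    · exact ⟨C, hC, hCn, Or.inr ⟨k, hdone.1, hdone.2, hs⟩⟩
    have hlt : (C k).card < (B k).card := by
      have h1 := hs k
      by_cases hki : k = i
      · subst hki; simp at h1; omega
      · have : ¬ (B k).card < a k := fun h => hdone ⟨hki, h⟩
        simp [hki] at h1; omega
    obtain ⟨h, hhB, hhC, he⟩ := mr_aug (hv k) (hC.1 k) (hB.1 k)
      (by rw [hCn k, hBn k]; exact hlt)
    set D : Fin n → Finset γ := fun m => if m = k then insert h (C k) else (C m).erase h with hD
    have hDk : D k = insert h (C k) := by simp [hD]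
    have hDm : ∀ m, m ≠ k → D m = (C m).erase h := by intro m hm; simp [hD, hm]
    have hDA : IsAlloc n M D := by
      constructor
      · intro m
        by_cases hm : m = k
        · subst hm; rw [hDk]; exact insert_subset (hB.1 _ hhB) (hC.1 _)
        · rw [hDm m hm]; exact (erase_subset _ _).trans (hC.1 m)
      · have aux : ∀ m, m ≠ k → Disjoint (D k) (D m) := by
          intro m hm
          rw [hDk, hDm m hm, disjoint_insert_left]
          exact ⟨notMem_erase _ _, (hC.2 k m (Ne.symm hm)).mono_right (erase_subset _ _)⟩
        intro m m' hmm
        by_cases hm : m = k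
        · subst hm; exact aux _ (Ne.symm hmm)
        · by_cases hm' : m' = k
          · subst hm'; exact (aux _ hmm).symm
          · rw [hDm m hm, hDm m' hm']
            exact (hC.2 m m' hmm).mono (erase_subset _ _) (erase_subset _ _)
    have hDN : NonRedundant n v D := by
      intro m
      by_cases hm : m = k
      · subst hm; rw [hDk, he, card_insert_of_notMem hhC, hCn]
      · rw [hDm m hm]; exact mr_indep_sub (hv m) (hC.1 m) (erase_subset _ _) (hCn m)
    have hck : (D k).card = (C k).card + 1 := by rw [hDk, card_insert_of_notMem hhC]
    by_cases hown : ∃ l, h ∈ C l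
    · obtain ⟨l, hl⟩ := hown
      have hlk : l ≠ k := by rintro rfl; exact hhC hl
      have hhl : h ∉ B l := fun hh => (disjoint_left.1 (hB.2 k l (Ne.symm hlk))) hhB hh
      have hcl : (D l).card + 1 = (C l).card := by rw [hDm l hlk, card_erase_add_one hl]
      have hcm : ∀ m, m ≠ k → m ≠ l → D m = C m := by
        intro m hmk hml
        rw [hDm m hmk, erase_eq_of_notMem]
        exact fun hh => (disjoint_left.1 (hC.2 m l hml)) hh hl
      refine ih D l hDA hDN ?_ ?_
      · intro m
        have h1 := hs m
        by_cases hm : m = k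
        · subst hm
          rw [if_neg (Ne.symm hlk), hck]
          rw [if_pos rfl] at h1; omega
        · by_cases hm' : m = l
          · subst hm'
            rw [if_neg hm] at h1
            rw [if_pos rfl]; omega
          · rw [if_neg hm] at h1
            rw [if_neg hm', hcm m hm hm']; omega
      · have : (∑ m, (D m \ B m).card) < ∑ m, (C m \ B m).card := by
          apply sum_lt_sum
          · intro m _
            apply card_le_card
            by_cases hm : m = k
            · subst hm
              rw [hDk, insert_sdiff_of_mem _ hhB]
            · rw [hDm m hm]; exact sdiff_subset_sdiff (erase_subset _ _) (Subset.refl _)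
          · refine ⟨l, mem_univ _, card_lt_card ?_⟩
            rw [hDm l hlk, Finset.ssubset_iff_of_subset
              (sdiff_subset_sdiff (erase_subset _ _) (Subset.refl _))]
            exact ⟨h, mem_sdiff.2 ⟨hl, hhl⟩, fun hh => notMem_erase h _ (mem_sdiff.1 hh).1⟩
        omega
    · refine ⟨D, hDA, hDN, Or.inl ?_⟩
      intro m
      have h1 := hs m
      by_cases hm : m = k
      · subst hm
        rw [if_pos rfl] at h1; omega
      · rw [if_neg hm] at h1
        rw [hDm m hm, erase_eq_of_notMem (fun hh => hown ⟨m, hh⟩)]; omega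

lemma exchange_main {γ : Type} [DecidableEq γ] {n : ℕ} {M : Finset γ}
    {v : Fin n → Finset γ → ℕ}
    (hv : ∀ i, MatroidRank M (v i)) {A B : Fin n → Finset γ}
    (hA : IsAlloc n M A) (hAn : NonRedundant n v A)
    (hB : IsAlloc n M B) (hBn : NonRedundant n v B) (i : Fin n)
    (hi : (A i).card < (B i).card) :
    ∃ D : Fin n → Finset γ, IsAlloc n M D ∧ 
      ((∀ l, v l (D l) = v l (A l) + (if l = i then 1 else 0)) ∨
       ∃ j, j ≠ i ∧ (B j).card < (A j).card ∧
        ∀ l, v l (D l) + (if l = j then 1 else 0) = v l (A l) + (if l = i then 1 else 0)) := by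
  obtain ⟨D, hD, hDn, h⟩ := exchange_s11 hv hB hBn (fun l => (A l).card) i hi _ A i hA hAn
    (fun l => rfl) (Nat.lt_succ_self _)
  refine ⟨D, hD, ?_⟩
  unfold NonRedundant at hDn hAn
  simp only [hDn, hAn]
  exact h

/-- Real-valued objective. -/
noncomputable def objF (n : ℕ) (w : Fin n → ℝ) (f : ℕ → EReal) (u : Fin n → ℕ) : ℝ :=
  ∑ i, w i * (f (u i)).toReal

lemma coe_f (f : ℕ → EReal) (hftop : ∀ k, f k ≠ ⊤) (k : ℕ) (h : f k ≠ ⊥) :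
    (((f k).toReal : ℝ) : EReal) = f k := EReal.coe_toReal (hftop k) h

lemma f_pos_ne_bot (f : ℕ → EReal) (hf : StrictMono f) (k : ℕ) (h : 0 < k) : f k ≠ ⊥ :=
  (lt_of_le_of_lt bot_le (hf h)).ne'

lemma sum_coe_obj {n : ℕ} (w : Fin n → ℝ) (f : ℕ → EReal) 
    (hftop : ∀ k, f k ≠ ⊤) (u : Fin n → ℕ) (s : Finset (Fin n)) (h : ∀ i ∈ s, f (u i) ≠ ⊥) :
    ∑ i ∈ s, (w i : EReal) * f (u i) = ((∑ i ∈ s, w i * (f (u i)).toReal : ℝ) : EReal) := by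
  have hc : ((∑ i ∈ s, w i * (f (u i)).toReal : ℝ) : EReal)
      = ∑ i ∈ s, ((w i * (f (u i)).toReal : ℝ) : EReal) :=
    map_sum (⟨⟨Real.toEReal, EReal.coe_zero⟩, EReal.coe_add⟩ : ℝ →+ EReal) _ _
  rw [hc]
  apply sum_congr rfl
  intro i hi
  rw [EReal.coe_mul, coe_f f hftop _ (h i hi)]

lemma welfare_coe {γ : Type} {n : ℕ} (w : Fin n → ℝ) (v : Fin n → Finset γ → ℕ) (f : ℕ → EReal)
    (hftop : ∀ k, f k ≠ ⊤) (A : Fin n → Finset γ) (h : ∀ i, f (v i (A i)) ≠ ⊥) :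
    Welfare n w v f A = (objF n w f (fun i => v i (A i)) : ℝ) :=
  sum_coe_obj w f hftop (fun i => v i (A i)) univ (fun i _ => h i)

lemma rwelfare_coe {γ : Type} {n : ℕ} (w : Fin n → ℝ) (v : Fin n → Finset γ → ℕ) (f : ℕ → EReal)
    (hf : StrictMono f) (hftop : ∀ k, f k ≠ ⊤) (h0 : f 0 = ⊥) (A : Fin n → Finset γ) :
    RWelfare n w v f A = (objF n w f (fun i => v i (A i)) : ℝ) := by
  unfold RWelfare objF
  rw [sum_coe_obj w f hftop (fun i => v i (A i)) (PosAgents n v A)]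
  · congr 1
    apply sum_subset (subset_univ _)
    intro i _ hi
    have : v i (A i) = 0 := by
      simpa [PosAgents] using hi
    simp [this, h0]
  · intro i hi
    exact f_pos_ne_bot f hf _ (by simpa [PosAgents] using hi)

lemma welfare_bot {γ : Type} {n : ℕ} (w : Fin n → ℝ) (hw : ∀ i, 0 < w i)
    (v : Fin n → Finset γ → ℕ) (f : ℕ → EReal)
    (A : Fin n → Finset γ) (i : Fin n) (h : f (v i (A i)) = ⊥) :
    Welfare n w v f A = ⊥ := by
  unfold Welfare
  rw [← add_sum_erase univ _ (mem_univ i), h, EReal.coe_mul_bot_of_pos (hw i), EReal.bot_add]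

lemma isRf_iff_fin {γ : Type} {n : ℕ} {M : Finset γ} {w : Fin n → ℝ}
    {v : Fin n → Finset γ → ℕ} {f : ℕ → EReal}
    (hf : StrictMono f) (hftop : ∀ k, f k ≠ ⊤) (h0 : f 0 ≠ ⊥) (A : Fin n → Finset γ) :
    IsRf n M w v f A ↔ IsAlloc n M A ∧ ∀ B, IsAlloc n M B →
      objF n w f (fun i => v i (B i)) ≤ objF n w f (fun i => v i (A i)) := by
  have hall : ∀ k, f k ≠ ⊥ := by
    intro k
    rcases Nat.eq_zero_or_pos k with rfl | hk
    · exact h0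
    · exact f_pos_ne_bot f hf k hk
  have hW : ∀ B : Fin n → Finset γ,
      Welfare n w v f B = (objF n w f (fun i => v i (B i)) : ℝ) :=
    fun B => welfare_coe w v f hftop B (fun i => hall _)
  constructor
  · rintro ⟨hA, h1, -⟩
    refine ⟨hA, fun B hB => ?_⟩
    have := h1 ⟨A, hA, by rw [hW]; exact EReal.coe_ne_bot _⟩ B hB
    rw [hW, hW] at this
    exact EReal.coe_le_coe_iff.1 this
  · rintro ⟨hA, h⟩
    refine ⟨hA, fun _ B hB => ?_, fun hbot => ?_⟩
    · rw [hW, hW]; exact EReal.coe_le_coe_iff.2 (h B hB)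
    · exact absurd (hbot A hA) (by rw [hW]; exact EReal.coe_ne_bot _)

lemma isRf_iff_bot {γ : Type} {n : ℕ} {M : Finset γ} {w : Fin n → ℝ} (hw : ∀ i, 0 < w i)
    {v : Fin n → Finset γ → ℕ} {f : ℕ → EReal}
    (hf : StrictMono f) (hftop : ∀ k, f k ≠ ⊤) (h0 : f 0 = ⊥) (A : Fin n → Finset γ) :
    IsRf n M w v f A ↔ IsAlloc n M A ∧ ∀ B, IsAlloc n M B →
      ((PosAgents n v B).card < (PosAgents n v A).card ∨
        ((PosAgents n v B).card = (PosAgents n v A).card ∧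
          LexLE (PosAgents n v A) (PosAgents n v B))) ∧
      (PosAgents n v B = PosAgents n v A →
        objF n w f (fun i => v i (B i)) ≤ objF n w f (fun i => v i (A i))) := by
  have hR : ∀ B : Fin n → Finset γ,
      RWelfare n w v f B = (objF n w f (fun i => v i (B i)) : ℝ) :=
    fun B => rwelfare_coe w v f hf hftop h0 B
  have hP : ∀ B : Fin n → Finset γ, Welfare n w v f B ≠ ⊥ → PosAgents n v B = univ := by
    intro B hB
    ext i
    simp only [PosAgents, mem_filter, mem_univ, true_and, iff_true]
    by_contra hi
    apply hB
    refine welfare_bot w hw v f B i ?_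
    rw [Nat.eq_zero_of_not_pos hi, h0]
  have hPW : ∀ B : Fin n → Finset γ, PosAgents n v B = univ →
      Welfare n w v f B = (objF n w f (fun i => v i (B i)) : ℝ) := by
    intro B hB
    apply welfare_coe w v f hftop
    intro i
    have : i ∈ PosAgents n v B := by rw [hB]; exact mem_univ i
    exact f_pos_ne_bot f hf _ (by simpa [PosAgents] using this)
  by_cases hex : ∃ B, IsAlloc n M B ∧ Welfare n w v f B ≠ ⊥
  · obtain ⟨B0, hB0, hB0'⟩ := hex
    constructor
    · rintro ⟨hA, h1, -⟩
      have h1 := h1 ⟨B0, hB0, hB0'⟩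
      have hA' : PosAgents n v A = univ := by
        apply hP
        intro h
        have := h1 B0 hB0
        rw [h] at this
        exact hB0' (le_bot_iff.1 this)
      refine ⟨hA, fun B hB => ⟨?_, fun he => ?_⟩⟩
      · by_cases hBu : PosAgents n v B = univ
        · right; rw [hBu, hA']; exact ⟨rfl, Or.inl rfl⟩
        · left; rw [hA']; exact card_lt_card (ssubset_univ_iff.2 hBu)
      · have := h1 B hB
        rw [hPW A hA', hPW B (he.trans hA')] at this
        exact EReal.coe_le_coe_iff.1 this
    · rintro ⟨hA, h⟩
      have hA' : PosAgents n v A = univ := by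
        have h1 := (h B0 hB0).1
        rw [hP B0 hB0'] at h1
        have h2 : (PosAgents n v A).card ≤ (univ : Finset (Fin n)).card :=
          card_le_card (subset_univ _)
        exact eq_of_subset_of_card_le (subset_univ _) (by omega)
      refine ⟨hA, fun _ B hB => ?_, fun hbot => absurd (hbot B0 hB0) hB0'⟩
      by_cases hBb : Welfare n w v f B = ⊥
      · rw [hBb]; exact bot_le
      · rw [hPW A hA', hPW B (hP B hBb)]
        exact EReal.coe_le_coe_iff.2 ((h B hB).2 ((hP B hBb).trans hA'.symm))
  · constructor
    · rintro ⟨hA, -, h⟩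
      push Not at hex
      have h := h hex
      simp only [hR, EReal.coe_le_coe_iff] at h
      exact ⟨hA, h⟩
    · rintro ⟨hA, h⟩
      refine ⟨hA, fun h' => absurd h' hex, fun _ => ?_⟩
      simp only [hR, EReal.coe_le_coe_iff]
      exact h

/-- Priority of agent `i` for the increment from utility `k` to `k + 1`. -/
noncomputable def gain {n : ℕ} (w : Fin n → ℝ) (f : ℕ → EReal) (i : Fin n) (k : ℕ) : EReal :=
  if f k = ⊥ then ⊤ else ((w i * ((f (k + 1)).toReal - (f k).toReal) : ℝ) : EReal)

noncomputable def prio {n : ℕ} (w : Fin n → ℝ) (f : ℕ → EReal) (i : Fin n) (k : ℕ) :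
    EReal ×ₗ (Fin n)ᵒᵈ := toLex (gain w f i k, OrderDual.toDual i)

lemma prio_lt_iff {n : ℕ} (w : Fin n → ℝ) (f : ℕ → EReal) (i j : Fin n) (k m : ℕ) :
    prio w f i k < prio w f j m ↔
      gain w f i k < gain w f j m ∨ (gain w f i k = gain w f j m ∧ j < i) := by
  unfold prio
  rw [Prod.Lex.toLex_lt_toLex]
  simp

lemma prio_anti {n : ℕ} (w : Fin n → ℝ) (hw : ∀ i, 0 < w i) (f : ℕ → EReal) (hf : StrictMono f)
    (hftop : ∀ k, f k ≠ ⊤)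
    (hconc : ∀ k : ℕ, f (k + 2) + f k ≤ f (k + 1) + f (k + 1)) (i : Fin n) :
    Antitone (prio w f i) := by
  have : Antitone (gain w f i) := by
    apply antitone_nat_of_succ_le
    intro k
    unfold gain
    by_cases hk : f k = ⊥
    · rw [if_pos hk]; exact le_top
    · have h1 := f_pos_ne_bot f hf (k + 1) (by omega)
      have h2 := f_pos_ne_bot f hf (k + 2) (by omega)
      rw [if_neg hk, if_neg h1, EReal.coe_le_coe_iff]
      apply mul_le_mul_of_nonneg_left _ (hw i).le
      have := hconc k
      rw [← coe_f f hftop k hk, ← coe_f f hftop _ h1, ← coe_f f hftop _ h2, ← EReal.coe_add,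
        ← EReal.coe_add, EReal.coe_le_coe_iff] at this
      show (f (k + 2)).toReal - _ ≤ _
      linarith
  intro k m hkm
  unfold prio
  rw [Prod.Lex.toLex_le_toLex]
  rcases (this hkm).lt_or_eq with h | h
  · exact Or.inl h
  · exact Or.inr ⟨h, le_rfl⟩

lemma obj_add {n : ℕ} (w : Fin n → ℝ) (f : ℕ → EReal) (u u' : Fin n → ℕ) (i : Fin n)
    (h : ∀ l, u' l = u l + (if l = i then 1 else 0)) :
    objF n w f u' = objF n w f u + w i * ((f (u i + 1)).toReal - (f (u i)).toReal) := by
  unfold objF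
  rw [← add_sum_erase univ _ (mem_univ i), ← add_sum_erase (a := i) univ _ (mem_univ i)]
  have : ∑ x ∈ univ.erase i, w x * (f (u' x)).toReal = ∑ x ∈ univ.erase i, w x * (f (u x)).toReal := by
    apply sum_congr rfl
    intro x hx
    rw [h x, if_neg (ne_of_mem_erase hx), add_zero]
  rw [this, h i, if_pos rfl]
  ring

lemma toReal_step {f : ℕ → EReal} (hf : StrictMono f) (hftop : ∀ k, f k ≠ ⊤) (k : ℕ)
    (hk : f k ≠ ⊥) : (f k).toReal < (f (k + 1)).toReal := by
  have := hf (Nat.lt_succ_self k)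
  rw [← coe_f f hftop k hk, ← coe_f f hftop _ (f_pos_ne_bot f hf k.succ (by omega))] at this
  exact EReal.coe_lt_coe_iff.1 this

lemma no_add {γ : Type} {n : ℕ} {M : Finset γ} {w : Fin n → ℝ} (hw : ∀ i, 0 < w i)
    {v : Fin n → Finset γ → ℕ} {f : ℕ → EReal}
    (hf : StrictMono f) (hftop : ∀ k, f k ≠ ⊤) {A D : Fin n → Finset γ}
    (hA : IsRf n M w v f A) (hD : IsAlloc n M D) (i : Fin n)
    (h : ∀ l, v l (D l) = v l (A l) + (if l = i then 1 else 0)) : False := by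
  have e := obj_add w f (fun l => v l (A l)) (fun l => v l (D l)) i h
  have hlt : f (v i (A i)) ≠ ⊥ →
      objF n w f (fun l => v l (A l)) < objF n w f (fun l => v l (D l)) := by
    intro hb
    have := mul_pos (hw i) (sub_pos.2 (toReal_step hf hftop _ hb))
    linarith
  by_cases h0 : f 0 = ⊥
  · have h1 := ((isRf_iff_bot hw hf hftop h0 A).1 hA).2 D hD
    have hm : ∀ l, l ≠ i → v l (D l) = v l (A l) := by
      intro l hl; rw [h l, if_neg hl, add_zero]
    have hi : v i (D i) = v i (A i) + 1 := by rw [h i, if_pos rfl]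
    by_cases hz : v i (A i) = 0
    · have : PosAgents n v A ⊂ PosAgents n v D := by
        rw [Finset.ssubset_iff_of_subset]
        · exact ⟨i, by simp [PosAgents, hi], by simp [PosAgents, hz]⟩
        · intro l hl
          simp only [PosAgents, mem_filter, mem_univ, true_and] at hl ⊢
          rw [h l]; omega
      have := card_lt_card this
      omega
    · have : PosAgents n v D = PosAgents n v A := by
        ext l
        simp only [PosAgents, mem_filter, mem_univ, true_and]
        by_cases hl : l = i
        · subst hl; omega
        · rw [hm l hl]
      have h2 := h1.2 this
      have h3 := hlt (f_pos_ne_bot f hf _ (by omega))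
      linarith
  · have h1 := ((isRf_iff_fin hf hftop h0 A).1 hA).2 D hD
    have : f (v i (A i)) ≠ ⊥ := by
      rcases Nat.eq_zero_or_pos (v i (A i)) with hk | hk
      · rw [hk]; exact h0
      · exact f_pos_ne_bot f hf _ hk
    linarith [hlt this]

lemma swap_lt {γ : Type} {n : ℕ} {M : Finset γ} {w : Fin n → ℝ} (hw : ∀ i, 0 < w i)
    {v : Fin n → Finset γ → ℕ} {f : ℕ → EReal}
    (hf : StrictMono f) (hftop : ∀ k, f k ≠ ⊤) {A D : Fin n → Finset γ}
    (hA : IsRfTie n M w v f A) (hD : IsAlloc n M D) (i j : Fin n) (hji : j ≠ i) (m : ℕ)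
    (hm : v j (A j) = m + 1)
    (h : ∀ l, v l (D l) + (if l = j then 1 else 0) = v l (A l) + (if l = i then 1 else 0)) :
    prio w f i (v i (A i)) < prio w f j m := by
  have hi : v i (D i) = v i (A i) + 1 := by
    have := h i; rwa [if_pos rfl, if_neg (Ne.symm hji)] at this
  have hj : v j (D j) = m := by
    have := h j; rw [if_pos rfl, if_neg hji] at this; omega
  have ho : ∀ l, l ≠ i → l ≠ j → v l (D l) = v l (A l) := by
    intro l h1 h2; have := h l; rwa [if_neg h1, if_neg h2] at this
  have e : objF n w f (fun l => v l (D l)) + w j * ((f (m + 1)).toReal - (f m).toReal)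
      = objF n w f (fun l => v l (A l)) +
        w i * ((f (v i (A i) + 1)).toReal - (f (v i (A i))).toReal) := by
    have e1 := obj_add w f (fun l => v l (D l))
      (fun l => v l (D l) + (if l = j then 1 else 0)) j (fun l => rfl)
    have e2 := obj_add w f (fun l => v l (A l))
      (fun l => v l (D l) + (if l = j then 1 else 0)) i h
    simp only [hj] at e1 e2
    rw [← e1, ← e2]
  rw [prio_lt_iff]
  -- lexicographic tie-breaking
  have htie : IsRf n M w v f D → j < i := by
    intro hR
    by_contra hcon
    have hlt : i < j := lt_of_le_of_ne (not_lt.1 hcon) (Ne.symm hji)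
    refine hA.2.1 D hR ⟨i, by simp only [hi]; omega, fun l hl => ?_⟩
    exact (ho l hl.ne (hl.trans hlt).ne).symm
  have hfin : f (v i (A i)) ≠ ⊥ → f m ≠ ⊥ →
      objF n w f (fun l => v l (D l)) ≤ objF n w f (fun l => v l (A l)) →
      (objF n w f (fun l => v l (D l)) = objF n w f (fun l => v l (A l)) → IsRf n M w v f D) →
      gain w f i (v i (A i)) < gain w f j m ∨
        (gain w f i (v i (A i)) = gain w f j m ∧ j < i) := by
    intro h1 h2 h3 h4
    unfold gain
    rw [if_neg h1, if_neg h2, EReal.coe_lt_coe_iff, EReal.coe_eq_coe_iff]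
    rcases h3.lt_or_eq with h5 | h5
    · left; linarith
    · right; exact ⟨by linarith, htie (h4 h5)⟩
  by_cases h0 : f 0 = ⊥
  · have hA1 := ((isRf_iff_bot hw hf hftop h0 A).1 hA.1).2
    have h1 := hA1 D hD
    rcases Nat.eq_zero_or_pos (v i (A i)) with hz | hz
    · rcases Nat.eq_zero_or_pos m with hmz | hmz
      · right
        refine ⟨by unfold gain; rw [hz, hmz, if_pos h0, if_pos h0], ?_⟩
        have hiD : i ∈ PosAgents n v D := by simp [PosAgents, hi]
        have hiA : i ∉ PosAgents n v A := by simp [PosAgents, hz]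
        have hcard : ¬ (PosAgents n v D).card < (PosAgents n v A).card := by
          have : PosAgents n v D = insert i ((PosAgents n v A).erase j) := by
            ext l
            by_cases h1 : l = i
            · subst h1; simp [hiD]
            · by_cases h2 : l = j
              · subst h2; simp [PosAgents, h1, hj, hmz]
              · simp [PosAgents, h1, h2, ho l h1 h2]
          have hjA : j ∈ PosAgents n v A := by simp [PosAgents, hm]
          rw [this, card_insert_of_notMem (fun hh => hiA (mem_of_mem_erase hh)),
            card_erase_add_one hjA]
          omega
        rcases h1.1 with h2 | ⟨-, h2 | ⟨l, hlA, hlD, hl⟩⟩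
        · exact absurd h2 hcard
        · rw [← h2] at hiD; exact absurd hiD hiA
        · have hlj : l = j := by
            by_contra hlj
            have hli : l ≠ i := by rintro rfl; exact hlD hiD
            apply hlD
            simpa [PosAgents, ho l hli hlj] using hlA
          subst hlj
          rcases lt_or_gt_of_ne hji with h3 | h3
          · exact h3
          · exact absurd ((hl i h3).2 hiD) hiA
      · exfalso
        have : PosAgents n v A ⊂ PosAgents n v D := by
          rw [Finset.ssubset_iff_of_subset]
          · exact ⟨i, by simp [PosAgents, hi], by simp [PosAgents, hz]⟩
          · intro l hl
            simp only [PosAgents, mem_filter, mem_univ, true_and] at hl ⊢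
            by_cases h1 : l = i
            · subst h1; omega
            · by_cases h2 : l = j
              · subst h2; omega
              · rw [ho l h1 h2]; exact hl
        have := card_lt_card this
        omega
    · rcases Nat.eq_zero_or_pos m with hmz | hmz
      · left
        unfold gain
        rw [hmz, if_pos h0, if_neg (f_pos_ne_bot f hf _ hz)]
        exact EReal.coe_lt_top _
      · have hP : PosAgents n v D = PosAgents n v A := by
          ext l
          simp only [PosAgents, mem_filter, mem_univ, true_and]
          by_cases h1 : l = i
          · subst h1; omega
          · by_cases h2 : l = j
            · subst h2; omega
            · rw [ho l h1 h2]
        refine hfin (f_pos_ne_bot f hf _ hz) (f_pos_ne_bot f hf _ hmz) (h1.2 hP) ?_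
        intro heq
        rw [isRf_iff_bot hw hf hftop h0]
        refine ⟨hD, fun B hB => ?_⟩
        rw [hP, heq]
        exact hA1 B hB
  · have hall : ∀ k, f k ≠ ⊥ := by
      intro k
      rcases Nat.eq_zero_or_pos k with rfl | hk
      · exact h0
      · exact f_pos_ne_bot f hf k hk
    have hA1 := ((isRf_iff_fin hf hftop h0 A).1 hA.1).2
    refine hfin (hall _) (hall _) (hA1 D hD) ?_
    intro heq
    rw [isRf_iff_fin hf hftop h0]
    refine ⟨hD, fun B hB => ?_⟩
    rw [heq]; exact hA1 B hB

/-- Combined consequence: an agent that is larger in `B` than in the optimal `A` has lower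
priority than some agent that is smaller in `B`. -/
lemma step {γ : Type} [DecidableEq γ] {n : ℕ} {M : Finset γ} {w : Fin n → ℝ}
    (hw : ∀ i, 0 < w i)
    {v : Fin n → Finset γ → ℕ} {f : ℕ → EReal}
    (hf : StrictMono f) (hftop : ∀ k, f k ≠ ⊤) (hv : ∀ i, MatroidRank M (v i))
    {A B : Fin n → Finset γ}
    (hA : IsRfTie n M w v f A) (hB : IsAlloc n M B) (hBn : NonRedundant n v B) (i : Fin n)
    (hi : (A i).card < (B i).card) :
    ∃ j m, (B j).card < (A j).card ∧ (A j).card = m + 1 ∧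
      prio w f i (A i).card < prio w f j m := by
  obtain ⟨D, hD, h | ⟨j, hji, hj, h⟩⟩ := exchange_main hv hA.1.1 hA.2.2 hB hBn i hi
  · exact (no_add hw hf hftop hA.1 hD i h).elim
  · obtain ⟨m, hm⟩ : ∃ m, (A j).card = m + 1 := ⟨(A j).card - 1, by omega⟩
    refine ⟨j, m, hj, hm, ?_⟩
    rw [← hA.2.2 i]
    exact swap_lt hw hf hftop hA hD i j hji m ((hA.2.2 j).trans hm) h

/-- Group-strategyproofness of `R^tie_f` for a strictly increasing concave `f` under
matroid-rank valuations: no nonempty group of agents can misreport their valuations so that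
every member of the group strictly gains (with respect to the true valuations). -/
theorem groupStrategyproofness {γ : Type} [DecidableEq γ] (n : ℕ)
    (f : ℕ → EReal) (hf : StrictMono f) (hftop : ∀ k, f k ≠ ⊤)
    (hconc : ∀ k : ℕ, f (k + 2) + f k ≤ f (k + 1) + f (k + 1)) :
    ¬ ∃ (M : Finset γ) (w : Fin n → ℝ) (v v' : Fin n → Finset γ → ℕ)
        (S : Finset (Fin n)) (A A' : Fin n → Finset γ),
      (∀ i, 0 < w i) ∧
      (∀ i, MatroidRank M (v i)) ∧ (∀ i, MatroidRank M (v' i)) ∧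
      S.Nonempty ∧ (∀ j ∉ S, v j = v' j) ∧
      IsRfTie n M w v f A ∧ IsRfTie n M w v' f A' ∧
      ∀ i ∈ S, v i (A i) < v i (A' i) := by
  rintro ⟨M, w, v, v', S, A, A', hw, hv, hv', hS, hvv, hA, hA', hgain⟩
  -- true-valuation independent version of `A'`
  choose Q hQsub hQind hQcard using fun i => mr_basis (hv i) (hA'.1.1.1 i)
  have hQA : IsAlloc n M Q :=
    ⟨fun i => (hQsub i).trans (hA'.1.1.1 i),
      fun i j hij => (hA'.1.1.2 i j hij).mono (hQsub i) (hQsub j)⟩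
  have hQle : ∀ i, (Q i).card ≤ (A' i).card := fun i => card_le_card (hQsub i)
  have hQS : ∀ i ∈ S, (A i).card < (Q i).card := by
    intro i hi
    rw [hQcard i, ← hA.2.2 i]; exact hgain i hi
  have hQN : ∀ i ∉ S, (Q i).card = (A' i).card := by
    intro i hi
    rw [hQcard i, hvv i hi, hA'.2.2 i]
  -- the truthful allocation, with the members of `S` removed
  set E : Fin n → Finset γ := fun i => if i ∈ S then ∅ else A i with hE
  have hES : ∀ i ∈ S, E i = ∅ := by intro i hi; simp [hE, hi]
  have hEN : ∀ i ∉ S, E i = A i := by intro i hi; simp [hE, hi]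
  have hEsub : ∀ i, E i ⊆ A i := by
    intro i
    by_cases hi : i ∈ S
    · rw [hES i hi]; exact empty_subset _
    · rw [hEN i hi]
  have hEA : IsAlloc n M E :=
    ⟨fun i => (hEsub i).trans (hA.1.1.1 i),
      fun i j hij => (hA.1.1.2 i j hij).mono (hEsub i) (hEsub j)⟩
  have hEn : NonRedundant n v' E := by
    intro i
    by_cases hi : i ∈ S
    · rw [hES i hi, (hv' i).2.2.2, card_empty]
    · rw [hEN i hi, ← hvv i hi, hA.2.2 i]
  -- gainers
  let T : Finset (Fin n) := univ.filter fun i => (A i).card < (Q i).card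
  have hT : T.Nonempty := by
    obtain ⟨i, hi⟩ := hS
    exact ⟨i, mem_filter.2 ⟨mem_univ _, hQS i hi⟩⟩
  obtain ⟨i, hiT, hmax⟩ := exists_max_image T (fun i => prio w f i (A i).card) hT
  have hi : (A i).card < (Q i).card := (mem_filter.1 hiT).2
  obtain ⟨j, m, hj, hjm, h1⟩ := step hw hf hftop hv hA hQA hQind i hi
  have hjS : j ∉ S := fun h => absurd (hQS j h) (by omega)
  have hj' : (A' j).card < (E j).card := by
    rw [hEN j hjS, ← hQN j hjS]; exact hj
  obtain ⟨k, p, hk, hkp, h2⟩ := step hw hf hftop hv' hA' hEA hEn j hj'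
  have hkT : (A k).card < (Q k).card := by
    by_cases hkS : k ∈ S
    · exact hQS k hkS
    · rw [hQN k hkS, ← hEN k hkS]; exact hk
  have h3 : prio w f j m ≤ prio w f j (A' j).card := by
    apply prio_anti w hw f hf hftop hconc j
    rw [hEN j hjS] at hj'; omega
  have h4 : prio w f k p ≤ prio w f k (A k).card := by
    apply prio_anti w hw f hf hftop hconc k
    have := hQle k; omega
  have h5 := hmax k (mem_filter.2 ⟨mem_univ _, hkT⟩)
  exact absurd (((h1.trans_le h3).trans h2).trans_le (h4.trans h5)) (lt_irrefl _)
end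

section
/- Let f be strictly increasing and let all agents have matroid-rank valuations. Then every R_f allocation is Pareto-optimal: if A is an R_f allocation, there is no allocation A' with v_i(A'_i) ≥ v_i(A_i) for all i ∈ N and v_i(A'_i) > v_i(A_i) for some i ∈ N. -/
open Finset

lemma welfare_sum_lt {n : ℕ} (s : Finset (Fin n)) (w : Fin n → ℝ) (hw : ∀ i, 0 < w i)
    (f : ℕ → EReal) (hf : StrictMono f) (hftop : ∀ k, f k ≠ ⊤) (a b : Fin n → ℕ)
    (hbot : ∀ i ∈ s, f (a i) ≠ ⊥) (hab : ∀ i, a i ≤ b i) (hs : ∃ i ∈ s, a i < b i) :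
    ∑ i ∈ s, (w i : EReal) * f (a i) < ∑ i ∈ s, (w i : EReal) * f (b i) := by
  have hb : ∀ i ∈ s, f (b i) ≠ ⊥ := fun i hi h =>
    hbot i hi (le_bot_iff.1 (h ▸ hf.monotone (hab i)))
  have key : ∀ c : Fin n → ℕ, (∀ i ∈ s, f (c i) ≠ ⊥) →
      ∑ i ∈ s, (w i : EReal) * f (c i) = ((∑ i ∈ s, w i * (f (c i)).toReal : ℝ) : EReal) := by
    intro c hc
    have hcoe : ∀ (t : Finset (Fin n)) (g : Fin n → ℝ),
        ((∑ i ∈ t, g i : ℝ) : EReal) = ∑ i ∈ t, (g i : EReal) := by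
      intro t g
      induction t using Finset.induction_on with
      | empty => simp
      | insert x t hx ih => rw [Finset.sum_insert hx, Finset.sum_insert hx, EReal.coe_add, ih]
    rw [hcoe]
    refine Finset.sum_congr rfl fun i hi => ?_
    rw [EReal.coe_mul, EReal.coe_toReal (hftop _) (hc i hi)]
  rw [key a hbot, key b hb, EReal.coe_lt_coe_iff]
  apply Finset.sum_lt_sum
  · intro i hi
    exact mul_le_mul_of_nonneg_left
      (EReal.toReal_le_toReal (hf.monotone (hab i)) (hbot i hi) (hftop _)) (hw i).le
  · obtain ⟨i, hi, h⟩ := hs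
    refine ⟨i, hi, mul_lt_mul_of_pos_left ?_ (hw i)⟩
    rw [← EReal.coe_lt_coe_iff, EReal.coe_toReal (hftop _) (hbot i hi),
      EReal.coe_toReal (hftop _) (hb i hi)]
    exact hf h

/-- Every `R_f` allocation (for strictly increasing `f`, positive weights, matroid-rank
valuations) is Pareto-optimal. -/
theorem rfParetoOptimal {γ : Type} [DecidableEq γ] {n : ℕ} (M : Finset γ)
    (w : Fin n → ℝ) (hw : ∀ i, 0 < w i)
    (v : Fin n → Finset γ → ℕ) (hv : ∀ i, MatroidRank M (v i))
    (f : ℕ → EReal) (hf : StrictMono f) (hftop : ∀ k, f k ≠ ⊤)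
    (A : Fin n → Finset γ) (hA : IsRf n M w v f A) :
    ParetoOptimal n M v A := by
  rintro ⟨B, hB, hle, i, hi⟩
  obtain ⟨-, h1, h2⟩ := hA
  by_cases hex : ∃ C, IsAlloc n M C ∧ Welfare n w v f C ≠ ⊥
  · have hmax := h1 hex
    have hAbot : Welfare n w v f A ≠ ⊥ := by
      obtain ⟨C, hC, hne⟩ := hex
      intro h
      exact hne (le_bot_iff.1 (h ▸ hmax C hC))
    refine absurd (hmax B hB) (not_le.2 ?_)
    refine welfare_sum_lt univ w hw f hf hftop (fun i => v i (A i)) (fun i => v i (B i))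
      ?_ hle ⟨i, mem_univ i, hi⟩
    intro j _ hj
    apply hAbot
    rw [Welfare, ← Finset.add_sum_erase _ _ (mem_univ j), hj, EReal.coe_mul_bot_of_pos (hw j),
      EReal.bot_add]
  · push Not at hex
    obtain ⟨h3, h4⟩ := h2 hex B hB
    have hsub : PosAgents n v A ⊆ PosAgents n v B := by
      intro j hj
      simp only [PosAgents, mem_filter, mem_univ, true_and] at hj ⊢
      exact hj.trans_le (hle j)
    have heq : PosAgents n v A = PosAgents n v B :=
      Finset.eq_of_subset_of_card_le hsub (by omega)
    refine absurd (h4 heq.symm) (not_le.2 ?_)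
    rw [RWelfare, RWelfare, ← heq]
    refine welfare_sum_lt _ w hw f hf hftop (fun i => v i (A i)) (fun i => v i (B i))
      ?_ hle ⟨i, ?_, hi⟩
    · intro j hj
      simp only [PosAgents, mem_filter, mem_univ, true_and] at hj
      exact (bot_le.trans_lt (hf hj)).ne'
    · rw [heq]
      simp only [PosAgents, mem_filter, mem_univ, true_and]
      omega
end
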